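/- arXiv:1409.7795 — 2 statements merged into one kernel-verified Lean document; each statement's English description precedes it below -/
import Mathlib

section
/- Let r ≥ 2 be an integer, let s > 0 be the unique real number with r/2 + s = (s+1)·log(s+1), and let α_r = e^{1/(s+1)}. Then for every tree T on n vertices, the number of r-matchings in T is at most (s+1) · (e^{1/r} · α_r)^{n-1}. -/
open SimpleGraph Filter

/-- The distance between two edges `e, f` of a graph `G`: the minimum distance between
a vertex incident to `e` and a vertex incident to `f`. -/
noncomputable def edgeDist {V : Type*} (G : SimpleGraph V) (e f : Sym2 V) : ℕ :=
  sInf {d : ℕ | ∃ u ∈ e, ∃ w ∈ f, G.dist u w = d}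

/-- `M` is an `r`-matching in `G`: a set of edges of `G` any two distinct members of which
are at distance at least `r`. -/
def IsRMatching {V : Type*} (G : SimpleGraph V) (r : ℕ) (M : Finset (Sym2 V)) : Prop :=
  (∀ e ∈ M, e ∈ G.edgeSet) ∧ ∀ e ∈ M, ∀ f ∈ M, e ≠ f → r ≤ edgeDist G e f

/-- The number of `r`-matchings in `G`. -/
noncomputable def numRMatchings {V : Type*} (G : SimpleGraph V) (r : ℕ) : ℕ :=
  Nat.card {M : Finset (Sym2 V) // IsRMatching G r M}

/-- `s_r(P_n)`: the number of `r`-matchings in the path on `n` vertices. -/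
noncomputable def pathMatchings (r n : ℕ) : ℕ :=
  numRMatchings (SimpleGraph.pathGraph n) r

theorem log5_le : Real.log 5 ≤ 1.63 := by
  rw [Real.log_le_iff_le_exp (by norm_num)]
  have h0 : (1.63 : ℝ) = 1 + 0.63 := by norm_num
  rw [h0, Real.exp_add]
  have he1 := Real.exp_one_gt_d9
  have h8 : (1.63 : ℝ) + 0.19845 + 0.0416 ≤ Real.exp 0.63 := by
    have := Real.sum_le_exp_of_nonneg (x := 0.63) (by norm_num) 4
    norm_num [Finset.sum_range_succ, Nat.factorial] at this ⊢
    linarith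
  have h9 : (2.7182818283 : ℝ) * (1.63 + 0.19845 + 0.0416) ≤ Real.exp 1 * Real.exp 0.63 :=
    mul_le_mul he1.le h8 (by norm_num) (by positivity)
  refine le_trans ?_ h9
  norm_num

theorem geo_sum (β : ℝ) (hβ : 1 < β) (k : ℕ) :
    ∑ i ∈ Finset.range k, (β⁻¹) ^ (2 * (i + 1)) = (1 - (β⁻¹) ^ (2 * k)) / (β ^ 2 - 1) := by
  have hne : β ^ 2 - 1 ≠ 0 := by nlinarith
  have hb : β * β⁻¹ = 1 := mul_inv_cancel₀ (by linarith)
  rw [eq_div_iff hne]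
  induction k with
  | zero => simp
  | succ k ih =>
    rw [Finset.sum_range_succ, add_mul, ih, mul_add, pow_add]
    linear_combination (β⁻¹) ^ (2 * k) * (β * β⁻¹ + 1) * hb

set_option maxHeartbeats 1000000 in
theorem num_facts (r : ℕ) (hr : 2 ≤ r) (s : ℝ) (hs : 0 < s)
    (heq : (r : ℝ) / 2 + s = (s + 1) * Real.log (s + 1)) (β : ℝ) (ρ : ℕ) (hρ : ρ = r / 2)
    (hβ : β = Real.exp (1 / r) * Real.exp (1 / (s + 1))) :
    1 < β ∧ (∀ n : ℕ, 1 + ((n : ℝ) - ρ) + ∑ i ∈ Finset.range ρ, (β⁻¹) ^ (2 * (i + 1)) ≤ β ^ n) ∧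
    1 ≤ β ^ (2 * ρ) * (β - 1) ∧ β ^ ρ ≤ s + 1 := by
  have hrR : (2 : ℝ) ≤ r := by exact_mod_cast hr
  obtain ⟨x, hx⟩ : ∃ x, x = s + 1 := ⟨_, rfl⟩
  have hx0 : 0 < x := by linarith
  obtain ⟨l, hl⟩ : ∃ l, l = Real.log x := ⟨_, rfl⟩
  obtain ⟨c, hc⟩ : ∃ c, c = 1 / x := ⟨_, rfl⟩
  have hc0 : 0 < c := by rw [hc]; positivity
  have hcx : c * x = 1 := by rw [hc]; field_simp
  have heq' : (r : ℝ) / 2 + x - 1 = x * l := by rw [hl, hx]; linarith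
  have hl1 : 1 ≤ l := by
    by_contra h
    push Not at h
    nlinarith
  have hxexp : Real.exp l = x := by rw [hl, Real.exp_log hx0]
  have hcr : c * r = 2 * (l - 1 + c) := by
    have : c * ((r : ℝ) / 2 + x - 1) = c * x * l := by rw [heq']; ring
    rw [hcx] at this
    linarith
  have he1 := Real.exp_one_gt_d9
  have he2 := Real.exp_one_lt_d9
  have hxe : Real.exp 1 ≤ x := by rw [← hxexp]; exact Real.exp_le_exp.2 hl1
  have hx27 : 2.7182818283 ≤ x := by linarith
  have hc368 : c ≤ 0.36788 := by
    have := mul_le_mul_of_nonneg_left hx27 hc0.le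
    linarith
  obtain ⟨q, hq⟩ : ∃ q : ℝ, q = 1 / r := ⟨_, rfl⟩
  have hq0 : 0 < q := by rw [hq]; positivity
  have hqr : q * r = 1 := by rw [hq]; field_simp
  have hq2 : q ≤ 1 / 2 := by nlinarith
  obtain ⟨b, hb⟩ : ∃ b, b = q + c := ⟨_, rfl⟩
  have hb0 : 0 < b := by linarith
  have hβb : β = Real.exp b := by rw [hβ, hb, hq, hc, hx, Real.exp_add]
  have hpow : ∀ n : ℕ, β ^ n = Real.exp (n * b) := fun n => by rw [hβb, Real.exp_nat_mul]
  have hβ1 : b + 1 ≤ β := by rw [hβb]; exact Real.add_one_le_exp b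
  have hρ1 : (ρ : ℝ) ≤ r / 2 := by rw [hρ]; exact_mod_cast Nat.cast_div_le
  have hρ2 : ((r : ℝ) - 1) / 2 ≤ ρ := by
    have : r ≤ 2 * ρ + 1 := by omega
    have : (r : ℝ) ≤ 2 * ρ + 1 := by exact_mod_cast this
    linarith
  -- u
  obtain ⟨u, hu⟩ : ∃ u, u = q * x := ⟨_, rfl⟩
  have hu0 : 0 < u := by rw [hu]; positivity
  have huc : u * c = q := by rw [hu]; linear_combination q * hcx
  have hbr : b * (r / 2) = l - 1 / 2 + c := by
    rw [hb]; linear_combination hqr / 2 + hcr / 2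
  have hbu : b = c * (1 + u) := by rw [hb]; linarith
  have hu136 : u ≤ 1.3593 := by
    -- l ≥ 2 - e/x
    have h1 : 1 - (x / Real.exp 1)⁻¹ ≤ Real.log (x / Real.exp 1) :=
      Real.one_sub_inv_le_log_of_pos (by positivity)
    rw [Real.log_div (by positivity) (by positivity), Real.log_exp, ← hl, inv_div] at h1
    have h2 : Real.exp 1 / x = Real.exp 1 * c := by rw [hc]; ring
    rw [h2] at h1
    -- u * (c r) = 1
    have h3 : u * (c * r) = 1 := by rw [← mul_assoc, huc, hqr]
    have h4 : 0.7357 ≤ c * r := by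
      rw [hcr]
      have h5 := mul_le_mul_of_nonneg_right he2.le hc0.le
      linarith
    have h6 := mul_le_mul_of_nonneg_left h4 hu0.le
    linarith
  have hcu : c ≤ 0.4 * u := by
    have h1 : Real.log (x / 5) ≤ x / 5 - 1 := Real.log_le_sub_one_of_pos (by positivity)
    rw [Real.log_div (by positivity) (by positivity), ← hl] at h1
    have h5 := log5_le
    have h3 : u * (c * r) = 1 := by rw [← mul_assoc, huc, hqr]
    -- c * r * c ≤ 0.4
    have h4 : c * r ≤ 0.4 * x := by rw [hcr]; linarith
    have h6 : c * r * c ≤ 0.4 := by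
      have := mul_le_mul_of_nonneg_right h4 hc0.le
      linarith
    have h7 : c = u * (c * r * c) := by linear_combination (-c) * h3
    have h8 := mul_le_mul_of_nonneg_left h6 hu0.le
    linarith
  have hlogu : 2 * u / (2 + u) ≤ Real.log (1 + u) := by
    have := Real.le_log_one_add_of_nonneg hu0.le
    rwa [add_comm u 2] at this
  have hb868 : b ≤ 0.86788 := by linarith
  have hkey : q + b ^ 2 / (2 * (1 + b)) ≤ Real.log (1 + u) := by
    refine le_trans ?_ hlogu
    have e1 : q + b ^ 2 / (2 * (1 + b)) ≤ u * 0.5952 := by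
      have : b / (1 + b) ≤ 0.4647 := by
        rw [div_le_iff₀ (by linarith)]; linarith
      have h2 : b ^ 2 / (2 * (1 + b)) = (b / (1 + b)) * (b / 2) := by field_simp
      have h3 : b ^ 2 / (2 * (1 + b)) ≤ 0.4647 * (b / 2) := by
        rw [h2]; exact mul_le_mul_of_nonneg_right this (by linarith)
      have h4 : b ≤ 0.4 * u * 2.3593 := by
        rw [hbu]; exact mul_le_mul hcu (by linarith) (by linarith) (by linarith)
      nlinarith
    refine e1.trans ?_
    rw [le_div_iff₀ (by linarith)]
    have := mul_le_mul_of_nonneg_left hu136 hu0.le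
    linarith
  have hlogb : Real.log (1 / b) = l - Real.log (1 + u) := by
    rw [hbu, one_div, Real.log_inv, Real.log_mul (by positivity) (by positivity), hc, one_div,
      Real.log_inv, hl]; ring
  refine ⟨by linarith, ?_, ?_, ?_⟩
  · intro n
    have hsum : ∑ i ∈ Finset.range ρ, (β⁻¹) ^ (2 * (i + 1)) ≤ 1 / (2 * b * (1 + b)) := by
      rw [geo_sum β (by linarith)]
      have h1 : 2 * b * (1 + b) ≤ β ^ 2 - 1 := by
        have := Real.quadratic_le_exp_of_nonneg (x := 2 * b) (by linarith)
        rw [hpow 2]; push_cast; nlinarith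
      have h2 : 0 < 2 * b * (1 + b) := by positivity
      have h3 : 0 ≤ (β⁻¹) ^ (2 * ρ) := by
        have : 0 < β := by linarith
        positivity
      rw [div_le_div_iff₀ (by linarith) h2]
      nlinarith
    have hexp : 1 / b + n - Real.log (1 / b) / b ≤ β ^ n := by
      rw [hpow]
      have h1 := Real.add_one_le_exp (n * b - Real.log (1 / b))
      rw [Real.exp_sub, Real.exp_log (by positivity)] at h1
      have h2 : Real.exp (n * b) = Real.exp (n * b) / (1 / b) * (1 / b) := by field_simp
      rw [h2]
      calc _ = (n * b - Real.log (1 / b) + 1) * (1 / b) := by field_simp; ring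
        _ ≤ _ := mul_le_mul_of_nonneg_right h1 (by positivity)
    refine le_trans ?_ hexp
    have hfin : b * (1 - ρ + 1 / (2 * b * (1 + b))) ≤ b * (1 / b - Real.log (1 / b) / b) := by
      have e1 : b * (1 - ρ + 1 / (2 * b * (1 + b))) = b - b * ρ + 1 / (2 * (1 + b)) := by
        field_simp
      have e2 : b * (1 / b - Real.log (1 / b) / b) = 1 - Real.log (1 / b) := by field_simp
      have e3 : b ^ 2 / (2 * (1 + b)) = b / 2 - 1 / 2 + 1 / (2 * (1 + b)) := by field_simp; ring
      rw [e1, e2, hlogb]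
      have e4 : b * ((r - 1) / 2) ≤ b * ρ := mul_le_mul_of_nonneg_left hρ2 hb0.le
      rw [e3] at hkey
      linarith
    have := le_of_mul_le_mul_left hfin hb0
    linarith
  · have h1 : Real.exp (2 * l - 1 + c - q) ≤ β ^ (2 * ρ) := by
      rw [hpow]; apply Real.exp_le_exp.2
      push_cast
      have e4 : b * ((r - 1) / 2) ≤ b * ρ := mul_le_mul_of_nonneg_left hρ2 hb0.le
      linarith
    have h2 : Real.exp (2 * l - 1 + c - q) = x * Real.exp (l - 1) * Real.exp (c - q) := by
      rw [← hxexp, ← Real.exp_add, ← Real.exp_add]; ring_nf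
    have h3 : 1 ≤ Real.exp (l - 1) := Real.one_le_exp (by linarith)
    have h4 : c - q + 1 ≤ Real.exp (c - q) := Real.add_one_le_exp _
    have h5 : x * (c - q + 1) ≤ β ^ (2 * ρ) := by
      refine le_trans ?_ h1
      rw [h2]
      have : x ≤ x * Real.exp (l - 1) := by nlinarith
      exact mul_le_mul this h4 (by linarith) (by positivity)
    have h6 : x * (c - q + 1) * b ≤ β ^ (2 * ρ) * (β - 1) :=
      mul_le_mul h5 (by linarith) hb0.le (by rw [hpow]; positivity)
    refine le_trans ?_ h6
    have h7 : x * (c - q + 1) * b = (c - q + 1) * (1 + u) := by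
      rw [hbu]; linear_combination (c - q + 1) * (1 + u) * hcx
    rw [h7]
    have h8 : 0 ≤ u * (1 - q) := mul_nonneg hu0.le (by linarith)
    linarith
  · rw [hpow, ← hx, ← hxexp]
    apply Real.exp_le_exp.2
    have : b * ρ ≤ b * (r / 2) := mul_le_mul_of_nonneg_left hρ1 hb0.le
    linarith

theorem quad_aux (a R C v w : ℝ) (ha : 0 ≤ a) (h1 : 1 ≤ v) (h2 : v ≤ w)
    (q1 : a - R + C ≤ 0) (q2 : a * w ^ 2 - R * w + C ≤ 0) : a * v ^ 2 - R * v + C ≤ 0 := by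
  rcases eq_or_lt_of_le (h1.trans h2) with h | h
  · have : v = 1 := le_antisymm (h ▸ h2) h1
    rw [this]; linarith
  · have key : (w - 1) * (a * v ^ 2 - R * v + C) = (w - v) * (a - R + C) +
        (v - 1) * (a * w ^ 2 - R * w + C) - a * ((v - 1) * (w - v) * (w - 1)) := by ring
    have t1 : (w - v) * (a - R + C) ≤ 0 := mul_nonpos_of_nonneg_of_nonpos (by linarith) q1
    have t2 : (v - 1) * (a * w ^ 2 - R * w + C) ≤ 0 :=
      mul_nonpos_of_nonneg_of_nonpos (by linarith) q2
    have t3 : 0 ≤ a * ((v - 1) * (w - v) * (w - 1)) :=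
      mul_nonneg ha (mul_nonneg (mul_nonneg (by linarith) (by linarith)) (by linarith))
    by_contra hc
    push Not at hc
    have := mul_pos (sub_pos.2 h) hc
    linarith

theorem count_real (β : ℝ) (ρ : ℕ) (hβ : 1 < β)
    (hM : ∀ n : ℕ, 1 + ((n : ℝ) - ρ) + ∑ i ∈ Finset.range ρ, (β⁻¹) ^ (2 * (i + 1)) ≤ β ^ n)
    (hB : 1 ≤ β ^ (2 * ρ) * (β - 1)) (h t : ℕ) (h1 : 1 ≤ h) (h2 : h ≤ ρ) :
    1 + ∑ i ∈ Finset.range h, (β⁻¹) ^ (2 * (ρ - h + i + 1)) + t * (β⁻¹) ^ (2 * (ρ - h + 1)) ≤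
      β ^ (h + t) := by
  obtain ⟨p, rfl⟩ : ∃ p, ρ = h + p := ⟨ρ - h, by omega⟩
  have hp : h + p - h = p := by omega
  rw [hp]
  obtain ⟨g, hg⟩ : ∃ g, g = β⁻¹ := ⟨_, rfl⟩
  have hgb : g * β = 1 := by rw [hg]; exact inv_mul_cancel₀ (by linarith)
  have hg0 : 0 < g := by rw [hg]; positivity
  have hg1 : g < 1 := by rw [hg]; exact inv_lt_one_of_one_lt₀ hβ
  have hgeo := geo_sum β hβ
  rw [← hg] at hgeo hM ⊢
  obtain ⟨D, hD⟩ : ∃ D, D = β ^ 2 - 1 := ⟨_, rfl⟩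
  have hD0 : 0 < D := by rw [hD]; nlinarith
  rw [← hD] at hgeo
  have hgp : ∀ k : ℕ, g ^ k * β ^ k = 1 := fun k => by rw [← mul_pow, hgb, one_pow]
  have hBg : g ^ (2 * (h + p)) ≤ β - 1 := by
    have := mul_le_mul_of_nonneg_left hB (pow_pos hg0 (2 * (h + p))).le
    rw [← mul_assoc, hgp] at this
    linarith
  have hs : ∑ i ∈ Finset.range h, g ^ (2 * (p + i + 1)) =
      (g ^ (2 * p) - g ^ (2 * (h + p))) / D := by
    have : ∑ i ∈ Finset.range h, g ^ (2 * (p + i + 1)) =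
        g ^ (2 * p) * ∑ i ∈ Finset.range h, g ^ (2 * (i + 1)) := by
      rw [Finset.mul_sum]
      refine Finset.sum_congr rfl fun i _ => ?_
      rw [← pow_add]; ring_nf
    rw [this, hgeo]; ring
  rw [hs]
  have hv1 : 1 ≤ β ^ p := one_le_pow₀ hβ.le
  have hvw : β ^ p ≤ β ^ (h + p - 1) := pow_le_pow_right₀ hβ.le (by omega)
  have hq := quad_aux (1 - g ^ (2 * (h + p)) / D) (β ^ (h + p + t)) (1 / D + t * g ^ 2)
    (β ^ p) (β ^ (h + p - 1)) ?_ hv1 hvw ?_ ?_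
  · -- conclude
    have hgpp : g ^ p * β ^ p = 1 := hgp p
    have hpos : 0 < g ^ p := pow_pos hg0 p
    have h3 := mul_nonpos_of_nonneg_of_nonpos (mul_pos hpos hpos).le hq
    have e1 : g ^ p * g ^ p * ((1 - g ^ (2 * (h + p)) / D) * (β ^ p) ^ 2 -
        β ^ (h + p + t) * β ^ p + (1 / D + t * g ^ 2)) =
        (1 - g ^ (2 * (h + p)) / D) - β ^ (h + t) + g ^ (2 * p) / D + t * g ^ (2 * (p + 1)) := by
      have e2 : β ^ (h + p + t) = β ^ (h + t) * β ^ p := by rw [← pow_add]; ring_nf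
      have e3 : g ^ (2 * p) = g ^ p * g ^ p := by rw [← pow_add]; ring_nf
      have e4 : g ^ (2 * (p + 1)) = g ^ p * g ^ p * g ^ 2 := by rw [← pow_add, ← pow_add]; ring_nf
      rw [e2, e3, e4]
      linear_combination ((1 - g ^ (2 * (h + p)) / D) - β ^ (h + t)) * (g ^ p * β ^ p + 1) * hgpp
    rw [e1] at h3
    have e5 : (g ^ (2 * p) - g ^ (2 * (h + p))) / D = g ^ (2 * p) / D - g ^ (2 * (h + p)) / D := by
      ring
    rw [e5]; linarith
  · rw [sub_nonneg, div_le_one hD0, hD]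
    nlinarith
  · have hm := hM (h + p + t)
    rw [hgeo] at hm
    push_cast at hm
    have e5 : (1 - g ^ (2 * (h + p))) / D = 1 / D - g ^ (2 * (h + p)) / D := by ring
    rw [e5] at hm
    have : (t : ℝ) * g ^ 2 ≤ t * 1 := mul_le_mul_of_nonneg_left (by nlinarith) (Nat.cast_nonneg _)
    linarith
  · obtain ⟨m, hm⟩ : ∃ m, h + p = m + 1 := ⟨h + p - 1, by omega⟩
    rw [hm] at hBg ⊢
    simp only [Nat.add_sub_cancel]
    have hbern : 1 + ((1 + t : ℕ) : ℝ) * (β - 1) ≤ β ^ (1 + t) := by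
      have := one_add_mul_le_pow (a := β - 1) (by linarith) (1 + t)
      simpa using this
    push_cast at hbern
    have h4 : 1 + (1 + (t : ℝ)) * g ^ (2 * (m + 1)) ≤ β ^ (1 + t) := by
      have := mul_le_mul_of_nonneg_left hBg (show (0 : ℝ) ≤ 1 + t by positivity)
      linarith
    have h5 := mul_le_mul_of_nonneg_left h4 (show (0 : ℝ) ≤ β ^ m * β ^ m by positivity)
    have e1 : β ^ (m + 1 + t) = β ^ (1 + t) * β ^ m := by rw [← pow_add]; ring_nf
    have e2 : g ^ (2 * (m + 1)) = g ^ m * g ^ m * g ^ 2 := by rw [← pow_add, ← pow_add]; ring_nf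
    have e3 := hgp m
    rw [e2] at h5
    rw [e1, e2]
    have e4 : (1 - g ^ 2) / D = g ^ 2 := by
      rw [div_eq_iff hD0.ne', hD]
      linear_combination (-g * β - 1) * hgb
    have e5 : (1 - g ^ m * g ^ m * g ^ 2 / D) * (β ^ m) ^ 2 - β ^ (1 + t) * β ^ m * β ^ m +
        (1 / D + t * g ^ 2) = (β ^ m) ^ 2 - β ^ (1 + t) * β ^ m * β ^ m + (1 - g ^ 2) / D + t * g ^ 2
        := by
      linear_combination (- g ^ 2 / D) * (g ^ m * β ^ m + 1) * e3
    rw [e5, e4]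
    have e6 : β ^ m * β ^ m * (1 + (1 + (t : ℝ)) * (g ^ m * g ^ m * g ^ 2)) =
        (β ^ m) ^ 2 + (1 + t) * g ^ 2 := by
      linear_combination ((1 + (t : ℝ)) * g ^ 2) * (g ^ m * β ^ m + 1) * e3
    rw [e6] at h5
    linarith

theorem counting (β : ℝ) (ρ : ℕ) (hβ : 1 < β) (hρ : 1 ≤ ρ)
    (hM : ∀ n : ℕ, 1 + ((n : ℝ) - ρ) + ∑ i ∈ Finset.range ρ, (β⁻¹) ^ (2 * (i + 1)) ≤ β ^ n)
    (hB : 1 ≤ β ^ (2 * ρ) * (β - 1)) {ι : Type*} (T : Finset ι) (dep : ι → ℕ) (hne : T.Nonempty)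
    (hdown : ∀ v ∈ T, ∀ k ≤ dep v, ∃ w ∈ T, dep w = k) :
    1 + ∑ v ∈ T, (β⁻¹) ^ (2 * (ρ - dep v)) ≤ β ^ T.card := by
  classical
  have hg0 : 0 < β⁻¹ := by positivity
  have hg1 : β⁻¹ ≤ 1 := (inv_lt_one_of_one_lt₀ hβ).le
  -- key: representatives
  have key : ∀ m : ℕ, (∀ k < m, ∃ w ∈ T, dep w = k) → ∃ R ⊆ T, R.card = m ∧
      ∑ v ∈ R, (β⁻¹) ^ (2 * (ρ - dep v)) = ∑ k ∈ Finset.range m, (β⁻¹) ^ (2 * (ρ - k)) := by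
    intro m hm
    haveI : Nonempty ι := ⟨hne.choose⟩
    choose! f hf using hm
    refine ⟨(Finset.range m).image f, ?_, ?_, ?_⟩
    · intro v hv
      obtain ⟨k, hk, rfl⟩ := Finset.mem_image.1 hv
      exact (hf k (Finset.mem_range.1 hk)).1
    · rw [Finset.card_image_of_injOn, Finset.card_range]
      intro a ha b hb hab
      have h1 := (hf a (by simpa using ha)).2
      have h2 := (hf b (by simpa using hb)).2
      rw [← h1, ← h2]; exact congrArg dep hab
    · rw [Finset.sum_image]
      · refine Finset.sum_congr rfl fun k hk => ?_
        rw [(hf k (Finset.mem_range.1 hk)).2]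
      · intro a ha b hb hab
        have h1 := (hf a (by simpa using ha)).2
        have h2 := (hf b (by simpa using hb)).2
        rw [← h1, ← h2]; exact congrArg dep hab
  obtain ⟨v0, hv0, hmax⟩ := Finset.exists_max_image T dep hne
  by_cases hh : ρ ≤ dep v0 + 1
  · obtain ⟨R, hRT, hRc, hRs⟩ := key ρ (fun k hk => hdown v0 hv0 k (by omega))
    rw [← Finset.sum_sdiff hRT, hRs]
    have h1 : ∑ v ∈ T \ R, (β⁻¹) ^ (2 * (ρ - dep v)) ≤ (T \ R).card • (1 : ℝ) :=
      Finset.sum_le_card_nsmul _ _ _ fun v _ => pow_le_one₀ hg0.le hg1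
    have h2 : (T \ R).card = T.card - ρ := by rw [Finset.card_sdiff_of_subset hRT, hRc]
    have h3 : ρ ≤ T.card := hRc ▸ Finset.card_le_card hRT
    rw [h2, nsmul_eq_mul, mul_one, Nat.cast_sub h3] at h1
    have h4 : ∑ k ∈ Finset.range ρ, (β⁻¹) ^ (2 * (ρ - k)) =
        ∑ i ∈ Finset.range ρ, (β⁻¹) ^ (2 * (i + 1)) := by
      rw [← Finset.sum_range_reflect]
      refine Finset.sum_congr rfl fun k hk => ?_
      have := Finset.mem_range.1 hk
      congr 2; omega
    rw [h4]
    linarith [hM T.card]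
  · obtain ⟨h, hh'⟩ : ∃ h, h = dep v0 + 1 := ⟨_, rfl⟩
    obtain ⟨R, hRT, hRc, hRs⟩ := key h (fun k hk => hdown v0 hv0 k (by omega))
    rw [← Finset.sum_sdiff hRT, hRs]
    have h1 : ∑ v ∈ T \ R, (β⁻¹) ^ (2 * (ρ - dep v)) ≤
        (T \ R).card • (β⁻¹) ^ (2 * (ρ - h + 1)) :=
      Finset.sum_le_card_nsmul _ _ _ fun v hv => by
        have := hmax v (Finset.mem_sdiff.1 hv).1
        exact pow_le_pow_of_le_one hg0.le hg1 (by omega)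
    have h2 : (T \ R).card + h = T.card := by
      rw [Finset.card_sdiff_of_subset hRT, hRc]
      have h3 : h ≤ T.card := hRc ▸ Finset.card_le_card hRT
      omega
    rw [nsmul_eq_mul] at h1
    have h4 : ∑ k ∈ Finset.range h, (β⁻¹) ^ (2 * (ρ - k)) =
        ∑ i ∈ Finset.range h, (β⁻¹) ^ (2 * (ρ - h + i + 1)) := by
      rw [← Finset.sum_range_reflect]
      refine Finset.sum_congr rfl fun k hk => ?_
      have := Finset.mem_range.1 hk
      congr 2; omega
    rw [h4]
    have := count_real β ρ hβ hM hB h (T \ R).card (by omega) (by omega)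
    rw [add_comm h, h2] at this
    linarith

section tree
variable {V : Type*} {G : SimpleGraph V}

theorem dcomm (G : SimpleGraph V) (u v : V) : G.dist u v = G.dist v u := SimpleGraph.dist_comm

theorem walk_edge_len {p q v w : V} (W : G.Walk v w) (h : s(p, q) ∈ W.edges) :
    (G.dist v p + 1 + G.dist q w ≤ W.length) ∨ (G.dist v q + 1 + G.dist p w ≤ W.length) := by
  induction W with
  | nil => simp at h
  | @cons a b c hab W ih =>
    rw [Walk.edges_cons, List.mem_cons] at h
    have hd : ∀ z, G.dist a z ≤ 1 + G.dist b z := by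
      intro z
      by_cases hr : G.Reachable b z
      · obtain ⟨X, hX⟩ := hr.exists_walk_length_eq_dist
        have := dist_le (Walk.cons hab X)
        rw [Walk.length_cons, hX] at this
        omega
      · have : ¬ G.Reachable a z := fun h => hr (hab.symm.reachable.trans h)
        rw [dist_eq_zero_of_not_reachable this]; omega
    rcases h with h | h
    · rw [Sym2.eq_iff] at h
      have h2 := dist_le W
      rcases h with ⟨rfl, rfl⟩ | ⟨rfl, rfl⟩
      · left; rw [Walk.length_cons, dist_self]; omega
      · right; rw [Walk.length_cons, dist_self]; omega
    · rw [Walk.length_cons]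
      rcases ih h with h | h
      · left; have := hd p; omega
      · right; have := hd q; omega

theorem cross_aux (hG : G.IsTree) {p q v w : V} (hpq : G.Adj p q)
    (hv : G.dist v p ≤ G.dist v q) (hw : G.dist w q ≤ G.dist w p) :
    G.dist v w = G.dist v p + 1 + G.dist q w := by
  have hc := hG.1
  have hb := (isAcyclic_iff_forall_adj_isBridge.1 hG.2) hpq
  rw [isBridge_iff_forall_walk_mem_edges] at hb
  have hpq1 : G.dist p q = 1 := dist_eq_one_iff_adj.2 hpq
  obtain ⟨X, hX⟩ := hc.exists_walk_length_eq_dist v p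
  obtain ⟨Y, hY⟩ := hc.exists_walk_length_eq_dist q w
  obtain ⟨Z, hZ⟩ := hc.exists_walk_length_eq_dist v w
  rw [dcomm G w q, dcomm G w p] at hw
  have hX' : s(p, q) ∉ X.edges := by
    intro h
    rcases walk_edge_len X h with h | h <;> omega
  have hY' : s(p, q) ∉ Y.edges := by
    intro h
    rcases walk_edge_len Y h with h | h <;> [skip; skip]
    · omega
    · omega
  have hZ' : s(p, q) ∈ Z.edges := by
    have := hb ((X.reverse.append Z).append Y.reverse)
    simp only [Walk.edges_append, Walk.edges_reverse, List.mem_append, List.mem_reverse] at this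
    tauto
  have t1 : G.dist v w ≤ G.dist v p + G.dist p w := hc.dist_triangle
  have t2 : G.dist p w ≤ G.dist p q + G.dist q w := hc.dist_triangle
  rcases walk_edge_len Z hZ' with h | h <;> omega

theorem adj_dist_ne (hG : G.IsTree) {p q : V} (hpq : G.Adj p q) (v : V) :
    G.dist v p ≠ G.dist v q := by
  intro h
  have := cross_aux hG hpq h.le h.ge
  rw [dist_self] at this; omega

theorem adj_dist (hG : G.IsTree) {p q : V} (hpq : G.Adj p q) (v : V) :
    G.dist v p = G.dist v q + 1 ∨ G.dist v q = G.dist v p + 1 := by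
  have h1 := adj_dist_ne hG hpq v
  have h2 : G.dist v p ≤ G.dist v q + G.dist q p := hG.1.dist_triangle
  have h3 : G.dist v q ≤ G.dist v p + G.dist p q := hG.1.dist_triangle
  rw [dcomm G q p] at h2
  rw [dist_eq_one_iff_adj.2 hpq] at h2 h3
  omega

theorem cross (hG : G.IsTree) {p q v w : V} (hpq : G.Adj p q)
    (hv : G.dist v p < G.dist v q) (hw : G.dist w q < G.dist w p) :
    G.dist v w = G.dist v p + 1 + G.dist q w := cross_aux hG hpq hv.le hw.le

/-- crossing edge is the edge itself -/
theorem cross_edge (hG : G.IsTree) {p q v w : V} (hpq : G.Adj p q) (hvw : G.Adj v w)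
    (hv : G.dist v p < G.dist v q) (hw : G.dist w q < G.dist w p) : v = p ∧ w = q := by
  have := cross hG hpq hv hw
  rw [dist_eq_one_iff_adj.2 hvw] at this
  have h1 : G.dist v p = 0 := by omega
  have h2 : G.dist q w = 0 := by omega
  exact ⟨(hG.1.dist_eq_zero_iff).1 h1, ((hG.1.dist_eq_zero_iff).1 h2).symm⟩

def ConvexS (G : SimpleGraph V) (W : Finset V) : Prop :=
  ∀ u ∈ W, ∀ v ∈ W, ∀ w, G.dist u w + G.dist w v = G.dist u v → w ∈ W

theorem side_convex (hG : G.IsTree) {p q u v w : V} (hpq : G.Adj p q)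
    (hu : G.dist u p < G.dist u q) (hv : G.dist v p < G.dist v q)
    (hw : G.dist u w + G.dist w v = G.dist u v) : G.dist w p < G.dist w q := by
  by_contra h
  have h' : G.dist w q < G.dist w p := lt_of_le_of_ne (not_lt.1 h) (adj_dist_ne hG hpq w).symm
  have h1 := cross hG hpq hu h'
  have h2 := cross hG hpq hv h'
  have h3 : G.dist u v ≤ G.dist u p + G.dist p v := hG.1.dist_triangle
  rw [dcomm G p v] at h3
  rw [dcomm G w v] at hw
  omega

theorem exists_par (hG : G.IsTree) {x v : V} (hne : v ≠ x) :
    ∃ p, G.Adj v p ∧ G.dist x p + 1 = G.dist x v := by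
  obtain ⟨X, hX⟩ := hG.1.exists_walk_length_eq_dist v x
  cases X with
  | nil => exact absurd rfl hne
  | @cons _ b _ hab Y =>
    refine ⟨b, hab, ?_⟩
    rw [Walk.length_cons] at hX
    have := dist_le Y
    have := adj_dist hG hab x
    have e1 := dcomm G b x
    have e2 := dcomm G v x
    omega

theorem par_unique (hG : G.IsTree) {x v p q : V} (hp : G.Adj v p) (hq : G.Adj v q)
    (hp1 : G.dist x p + 1 = G.dist x v) (hq1 : G.dist x q + 1 = G.dist x v) : p = q := by
  by_contra hne
  have h2 : G.dist q p < G.dist q v → False := by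
    intro h
    have := dist_eq_one_iff_adj.2 hq.symm
    rw [this] at h
    exact hne ((hG.1.dist_eq_zero_iff).1 (by omega)).symm
  have h3 : G.dist q v < G.dist q p := by
    have := adj_dist_ne hG hp q
    exact lt_of_not_ge fun h => h2 (lt_of_le_of_ne h this.symm)
  have := cross hG hp.symm (v := x) (w := q) (by omega) h3
  rw [dist_eq_one_iff_adj.2 hq] at this
  omega

/-- a geodesic sequence through `c` -/
theorem geo_seq (hG : G.IsTree) {x c u : V} (h : G.dist x u = G.dist x c + G.dist c u) :
    ∃ w : ℕ → V, w 0 = x ∧ w (G.dist x c) = c ∧ w (G.dist x u) = u ∧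
      ∀ i k, i ≤ k → k ≤ G.dist x u → G.dist (w i) (w k) = k - i := by
  obtain ⟨X, hX⟩ := hG.1.exists_walk_length_eq_dist x c
  obtain ⟨Y, hY⟩ := hG.1.exists_walk_length_eq_dist c u
  have hl : (X.append Y).length = G.dist x u := by rw [Walk.length_append]; omega
  have hle : ∀ i k, i ≤ k → k ≤ G.dist x u →
      G.dist ((X.append Y).getVert i) ((X.append Y).getVert k) ≤ k - i := by
    intro i k hik hk
    obtain ⟨m, rfl⟩ := Nat.exists_eq_add_of_le hik
    clear hik
    induction m with
    | zero => simp
    | succ m ih =>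
      have h1 := ih (by omega)
      have h2 := (X.append Y).adj_getVert_succ (i := i + m) (by omega)
      have h3 : G.dist ((X.append Y).getVert i) ((X.append Y).getVert (i + m + 1)) ≤ _ + _ :=
        hG.1.dist_triangle (v := (X.append Y).getVert (i + m))
      rw [dist_eq_one_iff_adj.2 h2] at h3
      rw [← add_assoc]
      omega
  refine ⟨(X.append Y).getVert, Walk.getVert_zero _, ?_, ?_, ?_⟩
  · rw [Walk.getVert_append, hX]; simp
  · rw [← hl, Walk.getVert_length]
  · intro i k hik hk
    refine le_antisymm (hle i k hik hk) ?_
    have h1 := hle 0 i (by omega) (by omega)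
    have h2 := hle k (G.dist x u) hk le_rfl
    have h3 : (X.append Y).getVert (G.dist x u) = u := by rw [← hl, Walk.getVert_length]
    rw [Walk.getVert_zero] at h1
    rw [h3] at h2
    have h4 : G.dist x u ≤ G.dist x ((X.append Y).getVert i) + G.dist ((X.append Y).getVert i) u :=
      hG.1.dist_triangle
    have h5 : G.dist ((X.append Y).getVert i) u ≤
      G.dist ((X.append Y).getVert i) ((X.append Y).getVert k) +
        G.dist ((X.append Y).getVert k) u := hG.1.dist_triangle
    omega

theorem edgeDist_le {e f : Sym2 V} {u w : V} (hu : u ∈ e) (hw : w ∈ f) :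
    edgeDist G e f ≤ G.dist u w := Nat.sInf_le ⟨u, hu, w, hw, rfl⟩

theorem edgeDist_comm (e f : Sym2 V) : edgeDist G e f = edgeDist G f e := by
  unfold edgeDist
  congr 1
  ext d
  constructor
  · rintro ⟨u, hu, w, hw, h⟩
    exact ⟨w, hw, u, hu, by rw [dcomm]; exact h⟩
  · rintro ⟨u, hu, w, hw, h⟩
    exact ⟨w, hw, u, hu, by rw [dcomm]; exact h⟩

/-- every edge is child-parent w.r.t. a root -/
theorem edge_par (hG : G.IsTree) (x : V) {e : Sym2 V} (he : e ∈ G.edgeSet) :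
    ∃ v p, e = s(v, p) ∧ G.Adj v p ∧ G.dist x p + 1 = G.dist x v := by
  induction e with
  | _ a b =>
    rw [mem_edgeSet] at he
    rcases adj_dist hG he x with h | h
    · exact ⟨a, b, rfl, he, h.symm⟩
    · exact ⟨b, a, Sym2.eq_swap, he.symm, h.symm⟩
end tree

section sets
variable {V : Type*} [Fintype V] {G : SimpleGraph V} {r : ℕ}

open Classical in
noncomputable def mats (G : SimpleGraph V) (r : ℕ) (P : Set (Sym2 V)) : Finset (Finset (Sym2 V)) :=
  Finset.univ.filter (fun M => IsRMatching G r M ∧ ∀ e ∈ M, e ∈ P)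

noncomputable def cnt (G : SimpleGraph V) (r : ℕ) (P : Set (Sym2 V)) : ℕ := (mats G r P).card

theorem mem_mats {P : Set (Sym2 V)} {M : Finset (Sym2 V)} :
    M ∈ mats G r P ↔ IsRMatching G r M ∧ ∀ e ∈ M, e ∈ P := by
  classical
  unfold mats
  simp

theorem cnt_mono {P Q : Set (Sym2 V)} (h : P ⊆ Q) : cnt G r P ≤ cnt G r Q := by
  apply Finset.card_le_card
  intro M hM
  rw [mem_mats] at hM ⊢
  exact ⟨hM.1, fun e he => h (hM.2 e he)⟩

theorem cnt_empty : cnt G r (∅ : Set (Sym2 V)) ≤ 1 := by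
  unfold cnt
  rw [Finset.card_le_one]
  intro M hM N hN
  rw [mem_mats] at hM hN
  have h1 : M = ∅ := Finset.eq_empty_of_forall_notMem fun e he => hM.2 e he
  have h2 : N = ∅ := Finset.eq_empty_of_forall_notMem fun e he => hN.2 e he
  rw [h1, h2]

theorem IsRMatching.sub {M N : Finset (Sym2 V)} (h : IsRMatching G r M) (hN : N ⊆ M) :
    IsRMatching G r N :=
  ⟨fun e he => h.1 e (hN he), fun e he f hf => h.2 e (hN he) f (hN hf)⟩

theorem cnt_split {P P1 P2 : Set (Sym2 V)} (h : ∀ e ∈ P, e ∈ P1 ∨ e ∈ P2) :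
    (cnt G r P : ℝ) ≤ cnt G r P1 * cnt G r P2 := by
  classical
  have : mats G r P ⊆ Finset.image₂ (· ∪ ·) (mats G r P1) (mats G r P2) := by
    intro M hM
    rw [mem_mats] at hM
    rw [Finset.mem_image₂]
    refine ⟨M.filter (· ∈ P1), ?_, M.filter (· ∈ P2), ?_, ?_⟩
    · rw [mem_mats]
      exact ⟨hM.1.sub (Finset.filter_subset _ _), fun e he => (Finset.mem_filter.1 he).2⟩
    · rw [mem_mats]
      exact ⟨hM.1.sub (Finset.filter_subset _ _), fun e he => (Finset.mem_filter.1 he).2⟩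
    · ext e
      simp only [Finset.mem_union, Finset.mem_filter]
      have := hM.2 e
      have h2 := h e
      tauto
  have h := (Finset.card_le_card this).trans (Finset.card_image₂_le _ _ _)
  unfold cnt
  exact_mod_cast h

theorem cnt_branch {ι : Type*} {P Q : Set (Sym2 V)} (T : Finset ι) (E : ι → Sym2 V) (b : ι → ℝ)
    (hQ : ∀ f ∈ P, f ∈ Q ∨ ∃ i ∈ T, f = E i)
    (hconf : ∀ i ∈ T, ∀ k ∈ T, E i ∈ P → E k ∈ P → E i ≠ E k → edgeDist G (E i) (E k) < r)
    (hb0 : ∀ i ∈ T, 0 ≤ b i)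
    (hb : ∀ i ∈ T, E i ∈ P → (cnt G r {f | f ∈ P ∧ f ∈ Q ∧ r ≤ edgeDist G (E i) f} : ℝ) ≤ b i) :
    (cnt G r P : ℝ) ≤ cnt G r Q + ∑ i ∈ T, b i := by
  classical
  have hsub : mats G r P ⊆ mats G r Q ∪ (T.filter (fun i => E i ∈ P)).biUnion (fun i =>
      (mats G r {f | f ∈ P ∧ f ∈ Q ∧ r ≤ edgeDist G (E i) f}).image (insert (E i))) := by
    intro M hM
    rw [mem_mats] at hM
    rw [Finset.mem_union]
    by_cases hMQ : ∀ e ∈ M, e ∈ Q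
    · left; rw [mem_mats]; exact ⟨hM.1, hMQ⟩
    · right
      push Not at hMQ
      obtain ⟨e, heM, heQ⟩ := hMQ
      obtain ⟨i, hi, rfl⟩ := (hQ e (hM.2 e heM)).resolve_left heQ
      rw [Finset.mem_biUnion]
      refine ⟨i, Finset.mem_filter.2 ⟨hi, hM.2 _ heM⟩, ?_⟩
      rw [Finset.mem_image]
      refine ⟨M.erase (E i), ?_, Finset.insert_erase heM⟩
      rw [mem_mats]
      refine ⟨hM.1.sub (Finset.erase_subset _ _), fun f hf => ?_⟩
      have hfM := Finset.mem_of_mem_erase hf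
      have hne := Finset.ne_of_mem_erase hf
      have hd := hM.1.2 _ heM f hfM hne.symm
      refine ⟨hM.2 f hfM, ?_, hd⟩
      rcases hQ f (hM.2 f hfM) with h | ⟨k, hk, rfl⟩
      · exact h
      · have := hconf i hi k hk (hM.2 _ heM) (hM.2 _ hfM) hne.symm
        omega
  have h1 : cnt G r P ≤ cnt G r Q + ∑ i ∈ T.filter (fun i => E i ∈ P),
      cnt G r {f | f ∈ P ∧ f ∈ Q ∧ r ≤ edgeDist G (E i) f} := by
    refine (Finset.card_le_card hsub).trans ((Finset.card_union_le _ _).trans ?_)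
    refine Nat.add_le_add le_rfl (Finset.card_biUnion_le.trans ?_)
    exact Finset.sum_le_sum fun i _ => Finset.card_image_le
  have h2 : (cnt G r P : ℝ) ≤ cnt G r Q + ∑ i ∈ T.filter (fun i => E i ∈ P),
      (cnt G r {f | f ∈ P ∧ f ∈ Q ∧ r ≤ edgeDist G (E i) f} : ℝ) := by exact_mod_cast h1
  refine h2.trans (add_le_add le_rfl ?_)
  calc _ ≤ ∑ i ∈ T.filter (fun i => E i ∈ P), b i := Finset.sum_le_sum fun i hi => by
        rw [Finset.mem_filter] at hi; exact hb i hi.1 hi.2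
    _ ≤ _ := Finset.sum_le_sum_of_subset_of_nonneg (Finset.filter_subset _ _) fun i hi _ => hb0 i hi

def Eset (G : SimpleGraph V) (W : Finset V) (x : V) (j : ℕ) : Set (Sym2 V) :=
  {e | e ∈ G.edgeSet ∧ ∀ u ∈ e, u ∈ W ∧ j ≤ G.dist x u}

theorem edge_split (hG : G.IsTree) {p q : V} (hpq : G.Adj p q) {e : Sym2 V} (he : e ∈ G.edgeSet) :
    (∀ u ∈ e, G.dist u p < G.dist u q) ∨ (∀ u ∈ e, G.dist u q < G.dist u p) ∨ e = s(p, q) := by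
  induction e with
  | _ a b =>
    rw [mem_edgeSet] at he
    have ha := adj_dist_ne hG hpq a
    have hb := adj_dist_ne hG hpq b
    simp only [Sym2.mem_iff, forall_eq_or_imp, forall_eq]
    rcases lt_or_gt_of_ne ha with h1 | h1 <;> rcases lt_or_gt_of_ne hb with h2 | h2
    · left; exact ⟨h1, h2⟩
    · right; right
      obtain ⟨rfl, rfl⟩ := cross_edge hG hpq he h1 h2
      rfl
    · right; right
      obtain ⟨rfl, rfl⟩ := cross_edge hG hpq he.symm h2 h1
      exact Sym2.eq_swap
    · right; left; exact ⟨h1, h2⟩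

open Classical in
noncomputable def side (G : SimpleGraph V) (W : Finset V) (p q : V) : Finset V :=
  W.filter (fun u => G.dist u p < G.dist u q)

theorem mem_side {W : Finset V} {p q u : V} :
    u ∈ side G W p q ↔ u ∈ W ∧ G.dist u p < G.dist u q := by
  classical
  unfold side; simp

theorem side_card (hG : G.IsTree) (W : Finset V) {p q : V} (hpq : G.Adj p q) :
    (side G W p q).card + (side G W q p).card = W.card := by
  classical
  unfold side
  rw [← Finset.card_filter_add_card_filter_not (s := W) (fun u => G.dist u p < G.dist u q)]
  congr 2
  ext u
  have := adj_dist_ne hG hpq u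
  simp only [Finset.mem_filter]
  constructor
  · rintro ⟨h1, h2⟩; exact ⟨h1, by omega⟩
  · rintro ⟨h1, h2⟩; exact ⟨h1, by omega⟩

theorem side_conv (hG : G.IsTree) {W : Finset V} (hW : ConvexS G W) {p q : V} (hpq : G.Adj p q) :
    ConvexS G (side G W p q) := by
  intro u hu v hv w hw
  rw [mem_side] at *
  exact ⟨hW u hu.1 v hv.1 w hw, side_convex hG hpq hu.2 hv.2 hw⟩

theorem cut_lemma (hG : G.IsTree) (β : ℝ) (ρ N : ℕ) (hβ : 1 < β) (hρ : 1 ≤ ρ)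
    (H : ∀ W : Finset V, W.card ≤ N → ConvexS G W → ∀ x ∈ W,
      (cnt G r (Eset G W x ρ) : ℝ) ≤ β ^ (W.card - 1)) (w : ℕ → V) (m : ℕ) :
    ∀ (lo : ℕ) (W : Finset V), W.card ≤ N → ConvexS G W →
      (∀ i k, lo ≤ i → i ≤ k → k ≤ lo + m → G.dist (w i) (w k) = k - i) →
      (∀ i, lo ≤ i → i ≤ lo + m → w i ∈ W) →
      (cnt G r {e | e ∈ G.edgeSet ∧ ∀ u ∈ e, u ∈ W ∧ ∀ i, lo ≤ i → i ≤ lo + m →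
        ρ ≤ G.dist (w i) u} : ℝ) * β ^ m ≤ β ^ (W.card - 1) := by
  induction m with
  | zero =>
    intro lo W hN hW hw hwW
    rw [pow_zero, mul_one]
    refine le_trans ?_ (H W hN hW (w lo) (hwW lo le_rfl (by omega)))
    norm_cast
    apply cnt_mono
    rintro e ⟨he, h⟩
    exact ⟨he, fun u hu => ⟨(h u hu).1, (h u hu).2 lo le_rfl (by omega)⟩⟩
  | succ m ih =>
    intro lo W hN hW hw hwW
    have hpq : G.Adj (w lo) (w (lo + 1)) := by
      rw [← dist_eq_one_iff_adj, hw lo (lo + 1) le_rfl (by omega) (by omega)]; omega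
    have hc := side_card hG W hpq
    have hp : w lo ∈ side G W (w lo) (w (lo + 1)) := by
      rw [mem_side, SimpleGraph.dist_self, dist_eq_one_iff_adj.2 hpq]
      exact ⟨hwW lo le_rfl (by omega), by omega⟩
    have hq : ∀ i, lo + 1 ≤ i → i ≤ lo + 1 + m → w i ∈ side G W (w (lo + 1)) (w lo) := by
      intro i h1 h2
      rw [mem_side, dcomm G (w i), dcomm G (w i), hw (lo + 1) i (by omega) h1 (by omega),
        hw lo i le_rfl (by omega) (by omega)]
      exact ⟨hwW i (by omega) (by omega), by omega⟩
    have h1 := H _ (by omega) (side_conv hG hW hpq) (w lo) hp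
    have h2 := ih (lo + 1) _ (by omega) (side_conv hG hW hpq.symm)
      (fun i k a b c => hw i k (by omega) b (by omega)) hq
    have hpos1 : 0 < (side G W (w lo) (w (lo + 1))).card := Finset.card_pos.2 ⟨_, hp⟩
    have hpos2 : 0 < (side G W (w (lo + 1)) (w lo)).card :=
      Finset.card_pos.2 ⟨_, hq (lo + 1) le_rfl (by omega)⟩
    have h3 := cnt_split (G := G) (r := r) (P := {e | e ∈ G.edgeSet ∧ ∀ u ∈ e, u ∈ W ∧
        ∀ i, lo ≤ i → i ≤ lo + (m + 1) → ρ ≤ G.dist (w i) u})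
      (P1 := Eset G (side G W (w lo) (w (lo + 1))) (w lo) ρ)
      (P2 := {e | e ∈ G.edgeSet ∧ ∀ u ∈ e, u ∈ side G W (w (lo + 1)) (w lo) ∧
        ∀ i, lo + 1 ≤ i → i ≤ lo + 1 + m → ρ ≤ G.dist (w i) u}) (by
      rintro e ⟨he, h⟩
      rcases edge_split hG hpq he with hs | hs | hs
      · left
        exact ⟨he, fun u hu => ⟨mem_side.2 ⟨(h u hu).1, hs u hu⟩,
          (h u hu).2 lo le_rfl (by omega)⟩⟩
      · right
        exact ⟨he, fun u hu => ⟨mem_side.2 ⟨(h u hu).1, hs u hu⟩,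
          fun i a b => (h u hu).2 i (by omega) (by omega)⟩⟩
      · exfalso
        have := (h (w lo) (by rw [hs]; simp)).2 lo le_rfl (by omega)
        rw [SimpleGraph.dist_self] at this
        omega)
    have hexp : W.card - 1 = ((side G W (w lo) (w (lo + 1))).card - 1) +
      ((side G W (w (lo + 1)) (w lo)).card - 1) + 1 := by omega
    rw [hexp, pow_succ, pow_succ, pow_add, ← mul_assoc]
    have hb0 : 0 < β := by linarith
    refine mul_le_mul_of_nonneg_right ?_ hb0.le
    calc _ ≤ _ := mul_le_mul_of_nonneg_right h3 (by positivity)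
      _ ≤ _ := by
        rw [mul_assoc]
        exact mul_le_mul h1 h2 (by positivity) (by positivity)

end sets

section main
variable {V : Type*} [Fintype V] {G : SimpleGraph V} {r : ℕ}

/-- no two compatible edges inside the branch -/
def SmallT (G : SimpleGraph V) (r : ℕ) (T : Set V) : Prop :=
  ∀ e ∈ G.edgeSet, ∀ f ∈ G.edgeSet, (∀ u ∈ e, u ∈ T) → (∀ u ∈ f, u ∈ T) → e ≠ f →
    edgeDist G e f < r

def Tset (G : SimpleGraph V) (W : Finset V) (x c : V) : Set V :=
  {v | v ∈ W ∧ G.dist x v = G.dist x c + G.dist c v}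

theorem child_iff (hG : G.IsTree) {x c a : V} (hca : G.Adj c a) (hxa : G.dist x a = G.dist x c + 1)
    (v : V) : G.dist x v = G.dist x a + G.dist a v ↔ G.dist v a < G.dist v c := by
  constructor
  · intro h
    by_contra hn
    have h1 : G.dist v c < G.dist v a := by
      have := adj_dist_ne hG hca v
      omega
    have h2 : G.dist x v ≤ G.dist x c + G.dist c v := hG.1.dist_triangle
    have e1 := dcomm G c v
    have e2 := dcomm G a v
    omega
  · intro h
    have := cross hG hca (v := x) (w := v) (by omega) h
    omega

theorem par_in (hG : G.IsTree) {W : Finset V} (hW : ConvexS G W) {x v p : V} (hx : x ∈ W)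
    (hv : v ∈ W) (hvp : G.Adj v p) (hp : G.dist x p + 1 = G.dist x v) : p ∈ W := by
  apply hW x hx v hv
  rw [dist_eq_one_iff_adj.2 hvp.symm]; exact hp

/-- parent of a branch vertex is in the branch or is the root edge -/
theorem par_side (hG : G.IsTree) {x c a v p : V} (hca : G.Adj c a)
    (hxa : G.dist x a = G.dist x c + 1) (hv : G.dist v a < G.dist v c) (hvp : G.Adj v p)
    (hp : G.dist x p + 1 = G.dist x v) :
    (v = a ∧ p = c) ∨ (G.dist p a < G.dist p c ∧ G.dist a p + 1 = G.dist a v) := by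
  rcases lt_or_gt_of_ne (adj_dist_ne hG hca p) with h | h
  · left
    have := cross_edge hG hca hvp.symm h hv
    exact ⟨this.2, this.1⟩
  · right
    refine ⟨h, ?_⟩
    have h1 := (child_iff hG hca hxa v).2 hv
    have h2 := (child_iff hG hca hxa p).2 h
    omega

theorem branch_conf (hG : G.IsTree) {W : Finset V} {x c a : V}
    (hca : G.Adj c a) (hxa : G.dist x a = G.dist x c + 1)
    (hsm : SmallT G r (Tset G W x a)) (hdep : ∀ v ∈ W, G.dist v a < G.dist v c → G.dist a v ≤ r)
    {v p v' p' : V} (hv : v ∈ W) (hp : p ∈ W) (hv' : v' ∈ W) (hp' : p' ∈ W)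
    (hva : G.dist v a < G.dist v c) (hva' : G.dist v' a < G.dist v' c)
    (hvp : G.Adj v p) (hxp : G.dist x p + 1 = G.dist x v)
    (hvp' : G.Adj v' p') (hxp' : G.dist x p' + 1 = G.dist x v')
    (hne : s(v, p) ≠ s(v', p')) : edgeDist G s(v, p) s(v', p') < r := by
  have key : ∀ {v p : V}, v ∈ W → p ∈ W → G.dist v a < G.dist v c → G.dist p a < G.dist p c →
      ∀ u ∈ s(v, p), u ∈ Tset G W x a := by
    intro v p hv hp h1 h2 u hu
    rw [Sym2.mem_iff] at hu
    rcases hu with rfl | rfl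
    · exact ⟨hv, (child_iff hG hca hxa _).2 h1⟩
    · exact ⟨hp, (child_iff hG hca hxa _).2 h2⟩
  rcases par_side hG hca hxa hva hvp hxp with ⟨rfl, rfl⟩ | ⟨h1, h1'⟩
  · rcases par_side hG hca hxa hva' hvp' hxp' with ⟨rfl, rfl⟩ | ⟨h2, h2'⟩
    · exact absurd rfl hne
    · have := edgeDist_le (G := G) (e := s(v, p)) (f := s(v', p')) (u := v) (w := p')
        (by simp) (by simp)
      have := hdep v' hv' hva'
      omega
  · rcases par_side hG hca hxa hva' hvp' hxp' with ⟨rfl, rfl⟩ | ⟨h2, h2'⟩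
    · have := edgeDist_le (G := G) (e := s(v, p)) (f := s(v', p')) (u := p) (w := v')
        (by simp) (by simp)
      have := hdep v hv hva
      rw [dcomm G p v'] at *
      omega
    · exact hsm _ hvp _ hvp' (key hv hp hva h1) (key hv' hp' hva' h2) hne

theorem exists_parfun (hG : G.IsTree) (x : V) : ∃ par : V → V, ∀ v, v ≠ x →
    G.Adj v (par v) ∧ G.dist x (par v) + 1 = G.dist x v := by
  have : ∀ v, ∃ p, v ≠ x → G.Adj v p ∧ G.dist x p + 1 = G.dist x v := by
    intro v
    by_cases h : v = x
    · exact ⟨x, fun h' => absurd h h'⟩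
    · obtain ⟨p, hp⟩ := exists_par hG h
      exact ⟨p, fun _ => hp⟩
  choose par hpar using this
  exact ⟨par, hpar⟩

theorem edge_par' (hG : G.IsTree) {x : V} {par : V → V} (hpar : ∀ v, v ≠ x →
    G.Adj v (par v) ∧ G.dist x (par v) + 1 = G.dist x v) {e : Sym2 V} (he : e ∈ G.edgeSet) :
    ∃ v, v ≠ x ∧ e = s(v, par v) := by
  obtain ⟨v, p, rfl, h1, h2⟩ := edge_par hG x he
  have hv : v ≠ x := by
    rintro rfl
    rw [SimpleGraph.dist_self] at h2; omega
  refine ⟨v, hv, ?_⟩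
  rw [par_unique hG h1 (hpar v hv).1 h2 (hpar v hv).2]

/-- Case Q -/
theorem case_small (hG : G.IsTree) (β : ℝ) (ρ : ℕ) (hβ : 1 < β)
    (hM : ∀ n : ℕ, 1 + ((n : ℝ) - ρ) + ∑ i ∈ Finset.range ρ, (β⁻¹) ^ (2 * (i + 1)) ≤ β ^ n)
    (W : Finset V) (hW : ConvexS G W) (x : V) (hx : x ∈ W) (j : ℕ) (hj : j ≤ ρ)
    (hsm : SmallT G r (Tset G W x x)) :
    (cnt G r (Eset G W x j) : ℝ) ≤ β ^ (W.card - 1 + (ρ - j)) := by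
  classical
  obtain ⟨par, hpar⟩ := exists_parfun hG x
  obtain ⟨T, hT⟩ : ∃ T, T = W.filter (fun v => j + 1 ≤ G.dist x v) := ⟨_, rfl⟩
  have hb := cnt_branch (G := G) (r := r) (P := Eset G W x j) (Q := ∅) T (fun v => s(v, par v))
    (fun _ => 1) ?_ ?_ (fun _ _ => zero_le_one) ?_
  · rw [Finset.sum_const, nsmul_eq_mul, mul_one] at hb
    have h0 : (cnt G r (∅ : Set (Sym2 V)) : ℝ) ≤ 1 := by exact_mod_cast cnt_empty
    rcases T.eq_empty_or_nonempty with hTe | ⟨v, hv⟩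
    · rw [hTe] at hb
      have : 1 ≤ β ^ (W.card - 1 + (ρ - j)) := one_le_pow₀ hβ.le
      rw [Finset.card_empty, Nat.cast_zero, add_zero] at hb
      linarith
    · rw [hT, Finset.mem_filter] at hv
      obtain ⟨w, hw0, -, hw1, hw⟩ := geo_seq hG (x := x) (c := x) (u := v) (by simp)
      have hsub : (Finset.range (j + 1)).image w ⊆ W \ T := by
        intro y hy
        obtain ⟨i, hi, rfl⟩ := Finset.mem_image.1 hy
        rw [Finset.mem_range] at hi
        have hd : G.dist x (w i) = i := by
          have := hw 0 i (by omega) (by omega)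
          rw [hw0] at this; simpa using this
        have hd2 : G.dist (w i) v = G.dist x v - i := by
          have := hw i (G.dist x v) (by omega) le_rfl
          rwa [hw1] at this
        rw [Finset.mem_sdiff, hT, Finset.mem_filter, hd]
        refine ⟨hW x hx v hv.1 _ (by omega), by omega⟩
      have hcard := Finset.card_le_card hsub
      rw [Finset.card_image_of_injOn, Finset.card_range] at hcard
      · have hTW : T ⊆ W := by rw [hT]; exact Finset.filter_subset _ _
        rw [Finset.card_sdiff_of_subset hTW] at hcard
        have h1 := hM (W.card - 1 + (ρ - j))
        have h2 : T.card + j + 1 ≤ W.card := by omega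
        have h3 : T.card + ρ ≤ W.card - 1 + (ρ - j) := by omega
        have h4 : (T.card : ℝ) + ρ ≤ ((W.card - 1 + (ρ - j) : ℕ) : ℝ) := by exact_mod_cast h3
        have h5 : 0 ≤ ∑ i ∈ Finset.range ρ, (β⁻¹) ^ (2 * (i + 1)) :=
          Finset.sum_nonneg fun i _ => by positivity
        linarith
      · intro a ha b hb hab
        simp only [Finset.coe_range, Set.mem_Iio] at ha hb
        have h1 := hw 0 a (by omega) (by omega)
        have h2 := hw 0 b (by omega) (by omega)
        rw [hab] at h1
        omega
  · intro f hf
    right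
    obtain ⟨v, hv, rfl⟩ := edge_par' hG hpar hf.1
    refine ⟨v, ?_, rfl⟩
    rw [hT, Finset.mem_filter]
    have h1 := hf.2 v (by simp)
    have h2 := hf.2 (par v) (by simp)
    have := (hpar v hv).2
    exact ⟨h1.1, by omega⟩
  · intro i _ k _ hi hk hne
    exact hsm _ hi.1 _ hk.1 (fun u hu => ⟨(hi.2 u hu).1, by simp⟩)
      (fun u hu => ⟨(hk.2 u hu).1, by simp⟩) hne
  · intro i _ _
    have : {f : Sym2 V | f ∈ Eset G W x j ∧ f ∈ (∅ : Set (Sym2 V)) ∧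
        r ≤ edgeDist G s(i, par i) f} = ∅ := by ext; simp
    simp only [this]
    exact_mod_cast cnt_empty

/-- Case (ii) -/
theorem case_far (hG : G.IsTree) (β : ℝ) (ρ : ℕ) (hβ : 1 < β) (hr : 2 * ρ ≤ r)
    (hB : 1 ≤ β ^ (2 * ρ) * (β - 1))
    (W : Finset V) (hW : ConvexS G W) (x : V) (hx : x ∈ W) (j : ℕ)
    (IH : ∀ W' : Finset V, W'.card < W.card → ConvexS G W' → x ∈ W' →
      (cnt G r (Eset G W' x j) : ℝ) ≤ β ^ (W'.card - 1 + (ρ - j)))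
    {c a : V} (hca : G.Adj c a) (hxa : G.dist x a = G.dist x c + 1) (ha : a ∈ W)
    (hsm : SmallT G r (Tset G W x a))
    (hfar : ∃ z ∈ W, G.dist z a < G.dist z c ∧ r + 1 ≤ G.dist a z) :
    (cnt G r (Eset G W x j) : ℝ) ≤ β ^ (W.card - 1 + (ρ - j)) := by
  classical
  obtain ⟨z0, hz0W, hz0a, hz0⟩ := hfar
  obtain ⟨z, hz, hmax⟩ := Finset.exists_max_image (side G W a c) (fun v => G.dist x v)
    ⟨z0, mem_side.2 ⟨hz0W, hz0a⟩⟩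
  rw [mem_side] at hz
  have hxz := (child_iff hG hca hxa z).2 hz.2
  have hxz0 := (child_iff hG hca hxa z0).2 hz0a
  have hzd : r + 1 ≤ G.dist a z := by
    have := hmax z0 (mem_side.2 ⟨hz0W, hz0a⟩)
    omega
  have hzx : z ≠ x := by
    rintro rfl
    rw [SimpleGraph.dist_self] at hxz; omega
  obtain ⟨p, hzp, hp⟩ := exists_par hG hzx
  have hpW := par_in hG hW hx hz.1 hzp hp
  have hps : G.dist p a < G.dist p c := by
    rcases par_side hG hca hxa hz.2 hzp hp with ⟨rfl, -⟩ | h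
    · rw [SimpleGraph.dist_self] at hzd; omega
    · exact h.1
  have hsd : ∀ u ∈ W, u ≠ z → G.dist u p < G.dist u z := by
    intro u hu hne
    by_contra hn
    have h1 : G.dist u z < G.dist u p := by
      have := adj_dist_ne hG hzp u
      omega
    have h2 := cross hG hzp.symm (v := x) (w := u) (by omega) h1
    have h3 : G.dist a u ≤ G.dist a z + G.dist z u := hG.1.dist_triangle
    have h4 : G.dist x u ≤ G.dist x a + G.dist a u := hG.1.dist_triangle
    have h5 := hmax u (mem_side.2 ⟨hu, (child_iff hG hca hxa u).1 (by omega)⟩)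
    have h6 : G.dist z u = 0 := by omega
    exact hne ((hG.1.dist_eq_zero_iff).1 h6).symm
  -- first set
  have hW1 : side G W p z ⊆ W.erase z := by
    intro u hu
    rw [mem_side] at hu
    rw [Finset.mem_erase]
    refine ⟨?_, hu.1⟩
    rintro rfl
    rw [SimpleGraph.dist_self] at hu; omega
  have hW1c := Finset.card_le_card hW1
  have hWpos : 0 < W.card := Finset.card_pos.2 ⟨x, hx⟩
  rw [Finset.card_erase_of_mem hz.1] at hW1c
  have b1 := IH (side G W p z) (by omega) (side_conv hG hW hzp.symm)
    (mem_side.2 ⟨hx, by omega⟩)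
  -- second set
  obtain ⟨W2, hW2⟩ : ∃ W2, W2 = insert a (side G W c a) := ⟨_, rfl⟩
  have hmem2 : ∀ u, u ∈ W2 ↔ u = a ∨ (u ∈ W ∧ G.dist u c < G.dist u a) := by
    intro u; rw [hW2, Finset.mem_insert, mem_side]
  have hca1 : G.dist c a = 1 := dist_eq_one_iff_adj.2 hca
  have hconv2 : ConvexS G W2 := by
    have haux : ∀ v w, v ∈ W → G.dist v c < G.dist v a →
        G.dist a w + G.dist w v = G.dist a v → w ∈ W2 := by
      intro v w hv hvs hw
      rw [hmem2]
      rcases lt_or_gt_of_ne (adj_dist_ne hG hca w) with h | h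
      · right; exact ⟨hW a ha v hv w hw, h⟩
      · left
        have h1 := cross hG hca hvs h
        have h2 := adj_dist hG hca v
        have e1 := dcomm G v w
        have e2 := dcomm G v a
        have : G.dist a w = 0 := by omega
        exact ((hG.1.dist_eq_zero_iff).1 this).symm
    intro u hu v hv w hw
    rcases (hmem2 u).1 hu with rfl | hu
    · rcases (hmem2 v).1 hv with rfl | hv
      · rw [SimpleGraph.dist_self] at hw
        rw [hmem2]; left
        exact (hG.1.dist_eq_zero_iff).1 (by omega)
      · exact haux v w hv.1 hv.2 hw
    · rcases (hmem2 v).1 hv with rfl | hv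
      · refine haux u w hu.1 hu.2 ?_
        rw [dcomm G v w, dcomm G w u, dcomm G v u]; omega
      · rw [hmem2]; right
        exact ⟨hW u hu.1 v hv.1 w hw, side_convex hG hca hu.2 hv.2 hw⟩
  have hcard2 : W2.card + (r + 1) ≤ W.card := by
    obtain ⟨w, hw0, -, hw1, hw⟩ := geo_seq hG (x := a) (c := a) (u := z) (by simp)
    have hd : ∀ i, i ≤ G.dist a z → G.dist a (w i) = i := by
      intro i hi
      have := hw 0 i (by omega) hi
      rw [hw0] at this; simpa using this
    have hsub : (Finset.Icc 1 (r + 1)).image w ⊆ W \ W2 := by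
      intro y hy
      obtain ⟨i, hi, rfl⟩ := Finset.mem_image.1 hy
      rw [Finset.mem_Icc] at hi
      have hdi := hd i (by omega)
      have hd2 : G.dist (w i) z = G.dist a z - i := by
        have := hw i (G.dist a z) (by omega) le_rfl
        rwa [hw1] at this
      have hbt : G.dist a (w i) + G.dist (w i) z = G.dist a z := by omega
      have hs := side_convex hG hca.symm (u := a) (v := z) (w := w i)
        (by rw [SimpleGraph.dist_self, dcomm G a c]; omega) hz.2 hbt
      rw [Finset.mem_sdiff, hmem2]
      refine ⟨hW a ha z hz.1 _ hbt, ?_⟩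
      rintro (h | h)
      · rw [h, SimpleGraph.dist_self] at hdi; omega
      · omega
    have hcard := Finset.card_le_card hsub
    have hsubW : W2 ⊆ W := by
      intro u hu
      rcases (hmem2 u).1 hu with rfl | h
      · exact ha
      · exact h.1
    rw [Finset.card_image_of_injOn, Nat.card_Icc, Finset.card_sdiff_of_subset hsubW] at hcard
    · omega
    · intro i hi k hk hik
      simp only [Finset.coe_Icc, Set.mem_Icc] at hi hk
      have h1 := hd i (by omega)
      have h2 := hd k (by omega)
      rw [hik] at h1; omega
  have hx2 : x ∈ W2 := (hmem2 x).2 (Or.inr ⟨hx, by omega⟩)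
  have b2 := IH W2 (by omega) hconv2 hx2
  have hpos2 : 0 < W2.card := Finset.card_pos.2 ⟨x, hx2⟩
  have hb := cnt_branch (G := G) (r := r) (P := Eset G W x j) (Q := Eset G (side G W p z) x j)
    {z} (fun v => s(v, p)) (fun _ => β ^ (W2.card - 1 + (ρ - j))) ?_ ?_ ?_ ?_
  · rw [Finset.sum_singleton] at hb
    refine hb.trans ((add_le_add b1 le_rfl).trans ?_)
    have hb0 : 0 < β := by linarith
    have e1 : β ^ ((side G W p z).card - 1 + (ρ - j)) ≤ β ^ (W.card - 2 + (ρ - j)) :=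
      pow_le_pow_right₀ hβ.le (by omega)
    have e2 : β ^ (W2.card - 1 + (ρ - j)) ≤ β ^ (W.card - r - 2 + (ρ - j)) :=
      pow_le_pow_right₀ hβ.le (by omega)
    have e3 : β ^ (W.card - 2 + (ρ - j)) = β ^ (W.card - r - 2 + (ρ - j)) * β ^ r := by
      rw [← pow_add]; congr 1; omega
    have e4 : β ^ (W.card - 1 + (ρ - j)) = β ^ (W.card - r - 2 + (ρ - j)) * β ^ r * β := by
      rw [← pow_add, ← pow_succ]; congr 1; omega
    have e5 : 1 ≤ β ^ r * (β - 1) := hB.trans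
      (mul_le_mul_of_nonneg_right (pow_le_pow_right₀ hβ.le hr) (by linarith))
    have e6 := mul_le_mul_of_nonneg_left e5 (pow_pos hb0 (W.card - r - 2 + (ρ - j))).le
    rw [e4]
    rw [e3] at e1
    linarith
  · intro f hf
    by_cases hzf : z ∈ f
    · right
      refine ⟨z, by simp, ?_⟩
      obtain ⟨w, rfl⟩ := Sym2.mem_iff_exists.1 hzf
      have hzw : G.Adj z w := hf.1
      have h1 := hsd w (hf.2 w (by simp)).1 hzw.ne'
      have := cross_edge hG hzp.symm hzw.symm h1
        (by rw [SimpleGraph.dist_self, dist_eq_one_iff_adj.2 hzp]; omega)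
      rw [this.1]
    · left
      refine ⟨hf.1, fun u hu => ⟨mem_side.2 ⟨(hf.2 u hu).1, hsd u (hf.2 u hu).1 ?_⟩,
        (hf.2 u hu).2⟩⟩
      rintro rfl; exact hzf hu
  · intro i hi k hk _ _ hne
    rw [Finset.mem_singleton] at hi hk
    rw [hi, hk] at hne
    exact absurd rfl hne
  · intro i _
    have hb0 : 0 < β := by linarith
    positivity
  · intro i hi hiP
    rw [Finset.mem_singleton] at hi
    subst hi
    refine le_trans ?_ b2
    norm_cast
    apply cnt_mono
    rintro f ⟨hfP, hfQ, hfd⟩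
    refine ⟨hfP.1, fun u hu => ⟨?_, (hfP.2 u hu).2⟩⟩
    rcases edge_split hG hca hfP.1 with hs | hs | hs
    · exact (hmem2 u).2 (Or.inr ⟨(hfP.2 u hu).1, hs u hu⟩)
    · exfalso
      have hne : s(i, p) ≠ f := by
        rintro rfl
        have := (hfQ.2 i (by simp)).1
        rw [mem_side, SimpleGraph.dist_self] at this
        omega
      have := hsm _ hzp _ hfP.1 ?_ ?_ hne
      · omega
      · intro y hy
        rw [Sym2.mem_iff] at hy
        rcases hy with rfl | rfl
        · exact ⟨hz.1, hxz⟩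
        · exact ⟨hpW, (child_iff hG hca hxa _).2 hps⟩
      · intro y hy
        exact ⟨(hfP.2 y hy).1, (child_iff hG hca hxa _).2 (hs y hy)⟩
    · rw [hs, Sym2.mem_iff] at hu
      rw [hmem2]
      rcases hu with rfl | rfl
      · right
        refine ⟨(hfP.2 u (by rw [hs]; simp)).1, ?_⟩
        rw [SimpleGraph.dist_self]; omega
      · left; rfl
end main

section fin
variable {V : Type*} [Fintype V] {G : SimpleGraph V} {r : ℕ}

theorem case_near (hG : G.IsTree) (β : ℝ) (ρ : ℕ) (hβ : 1 < β) (hρ : 1 ≤ ρ) (hr : 2 * ρ ≤ r)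
    (hM : ∀ n : ℕ, 1 + ((n : ℝ) - ρ) + ∑ i ∈ Finset.range ρ, (β⁻¹) ^ (2 * (i + 1)) ≤ β ^ n)
    (hB : 1 ≤ β ^ (2 * ρ) * (β - 1))
    (W : Finset V) (hW : ConvexS G W) (x : V) (hx : x ∈ W) (j : ℕ) (hj : j ≤ ρ)
    (IH : ∀ W' : Finset V, W'.card < W.card → ConvexS G W' → ∀ x ∈ W', ∀ j ≤ ρ,
      (cnt G r (Eset G W' x j) : ℝ) ≤ β ^ (W'.card - 1 + (ρ - j)))
    {c a : V} (hca : G.Adj c a) (hxa : G.dist x a = G.dist x c + 1) (ha : a ∈ W)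
    (hsm : SmallT G r (Tset G W x a))
    (hdep : ∀ v ∈ W, G.dist v a < G.dist v c → G.dist a v ≤ r)
    {u : V} (hu : u ∈ W) (hxu : G.dist x u = G.dist x c + G.dist c u)
    (hua : G.dist u c < G.dist u a) (hcu : ρ ≤ G.dist c u) :
    (cnt G r (Eset G W x j) : ℝ) ≤ β ^ (W.card - 1 + (ρ - j)) := by
  classical
  have hb0 : 0 < β := by linarith
  have hca1 : G.dist c a = 1 := dist_eq_one_iff_adj.2 hca
  obtain ⟨par, hpar⟩ := exists_parfun hG x
  obtain ⟨T, hT⟩ : ∃ T, T = side G W a c := ⟨_, rfl⟩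
  obtain ⟨W', hW'⟩ : ∃ W', W' = side G W c a := ⟨_, rfl⟩
  have hcard : W'.card + T.card = W.card := by rw [hT, hW']; exact side_card hG W hca
  have hmT : ∀ v, v ∈ T ↔ v ∈ W ∧ G.dist v a < G.dist v c := fun v => by rw [hT, mem_side]
  have hmW : ∀ v, v ∈ W' ↔ v ∈ W ∧ G.dist v c < G.dist v a := fun v => by rw [hW', mem_side]
  have hconv : ConvexS G W' := by rw [hW']; exact side_conv hG hW hca
  have haT : a ∈ T := by
    rw [hmT, SimpleGraph.dist_self, dcomm G a c]; exact ⟨ha, by omega⟩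
  have hxW : x ∈ W' := (hmW x).2 ⟨hx, by omega⟩
  have huW : u ∈ W' := (hmW u).2 ⟨hu, hua⟩
  have hTpos : 0 < T.card := Finset.card_pos.2 ⟨a, haT⟩
  have hWpos : 0 < W'.card := Finset.card_pos.2 ⟨x, hxW⟩
  have hTx : ∀ v ∈ T, v ≠ x := by
    rintro v hv rfl
    have h1 := (hmT v).1 hv
    have h2 := (hmW v).1 hxW
    omega
  have hcp : ∀ v ∈ T, G.dist c (par v) ≤ G.dist a v := by
    intro v hv
    have hp := hpar v (hTx v hv)
    rcases par_side hG hca hxa ((hmT v).1 hv).2 hp.1 hp.2 with ⟨-, h⟩ | ⟨h1, h2⟩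
    · rw [h, SimpleGraph.dist_self]; omega
    · have h3 : G.dist c (par v) ≤ G.dist c a + G.dist a (par v) := hG.1.dist_triangle
      omega
  have b1 := IH W' (by omega) hconv x hxW j hj
  have hb := cnt_branch (G := G) (r := r) (P := Eset G W x j) (Q := Eset G W' x j)
    T (fun v => s(v, par v))
    (fun v => β ^ (W'.card - 1 + (ρ - j)) * (β⁻¹) ^ (2 * (ρ - G.dist a v))) ?_ ?_ ?_ ?_
  · rw [← Finset.mul_sum] at hb
    have hc := counting β ρ hβ hρ hM hB T (fun v => G.dist a v) ⟨a, haT⟩ ?_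
    · have h1 := mul_le_mul_of_nonneg_left hc (pow_pos hb0 (W'.card - 1 + (ρ - j))).le
      rw [← pow_add] at h1
      have h2 : W'.card - 1 + (ρ - j) + T.card = W.card - 1 + (ρ - j) := by omega
      rw [h2] at h1
      linarith
    · intro v hv k hk
      obtain ⟨w, hw0, -, hw1, hw⟩ := geo_seq hG (x := a) (c := a) (u := v) (by simp)
      have hd : G.dist a (w k) = k := by
        have := hw 0 k (by omega) hk
        rw [hw0] at this; simpa using this
      have hd2 : G.dist (w k) v = G.dist a v - k := by
        have := hw k (G.dist a v) hk le_rfl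
        rwa [hw1] at this
      refine ⟨w k, ?_, hd⟩
      have hTc : ConvexS G T := by rw [hT]; exact side_conv hG hW hca.symm
      exact hTc a haT v hv _ (by have hk' : k ≤ G.dist a v := hk
                                 omega)
  · intro f hf
    obtain ⟨v, hv, rfl⟩ := edge_par' hG hpar hf.1
    have hvW := (hf.2 v (by simp)).1
    have hpW := (hf.2 (par v) (by simp)).1
    rcases lt_or_gt_of_ne (adj_dist_ne hG hca v) with h | h
    · left
      refine ⟨hf.1, fun y hy => ⟨?_, (hf.2 y hy).2⟩⟩
      rw [Sym2.mem_iff] at hy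
      have hvW' : v ∈ W' := (hmW v).2 ⟨hvW, h⟩
      rcases hy with rfl | rfl
      · exact hvW'
      · exact par_in hG hconv hxW hvW' (hpar v hv).1 (hpar v hv).2
    · right
      exact ⟨v, (hmT v).2 ⟨hvW, h⟩, rfl⟩
  · intro v hv v' hv' hvP hvP' hne
    have h1 := (hmT v).1 hv
    have h2 := (hmT v').1 hv'
    have hp1 := hpar v (hTx v hv)
    have hp2 := hpar v' (hTx v' hv')
    exact branch_conf hG hca hxa hsm hdep h1.1 (hvP.2 (par v) (by simp)).1 h2.1
      (hvP'.2 (par v') (by simp)).1 h1.2 h2.2 hp1.1 hp1.2 hp2.1 hp2.2 hne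
  · intro v _; positivity
  · intro v hv hvP
    have hcpv := hcp v hv
    by_cases hdd : ρ ≤ G.dist a v
    · have e : ρ - G.dist a v = 0 := by omega
      simp only [e, mul_zero, pow_zero, mul_one]
      refine le_trans ?_ b1
      norm_cast
      apply cnt_mono
      rintro f ⟨-, hf, -⟩
      exact hf
    · obtain ⟨y, hy⟩ : ∃ y, y = ρ - G.dist a v := ⟨_, rfl⟩
      obtain ⟨U, hU⟩ : ∃ U, U = G.dist x c := ⟨_, rfl⟩
      obtain ⟨w, hw0, hwc, hw1, hw⟩ := geo_seq hG hxu
      rw [← hU] at hwc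
      have hjU : j ≤ U + G.dist a v := by
        have h1 := (hvP.2 (par v) (by simp)).2
        have h2 : G.dist x (par v) ≤ G.dist x c + G.dist c (par v) := hG.1.dist_triangle
        omega
      obtain ⟨m, hm⟩ : ∃ m, m = U + y - (U - y) := ⟨_, rfl⟩
      have hcut := cut_lemma (r := r) hG β ρ W'.card hβ hρ (fun W0 h0 hc0 x0 hx0 => by
        have := IH W0 (by omega) hc0 x0 hx0 ρ le_rfl
        simpa using this) w m (U - y) W' le_rfl hconv
        (fun i k h1 h2 h3 => hw i k h2 (by omega))
        (fun i h1 h2 => by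
          have t1 := hw 0 i (by omega) (by omega)
          have t2 := hw i (G.dist x u) (by omega) le_rfl
          rw [hw0] at t1
          rw [hw1] at t2
          exact hconv x hxW u huW _ (by omega))
      have hsub : cnt G r {f | f ∈ Eset G W x j ∧ f ∈ Eset G W' x j ∧
          r ≤ edgeDist G s(v, par v) f} ≤ cnt G r {e | e ∈ G.edgeSet ∧ ∀ u ∈ e, u ∈ W' ∧
          ∀ i, U - y ≤ i → i ≤ U - y + m → ρ ≤ G.dist (w i) u} := by
        apply cnt_mono
        rintro f ⟨-, hf, hfd⟩
        refine ⟨hf.1, fun z hz => ⟨(hf.2 z hz).1, fun i h1 h2 => ?_⟩⟩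
        have t1 := edgeDist_le (G := G) (e := s(v, par v)) (f := f) (u := par v) (w := z)
          (by simp) hz
        have t2 : G.dist (par v) z ≤ G.dist (par v) c + G.dist c z := hG.1.dist_triangle
        have t3 : G.dist c z ≤ G.dist c (w i) + G.dist (w i) z := hG.1.dist_triangle
        have t4 : G.dist c (w i) ≤ y := by
          rcases le_total i U with h | h
          · have := hw i U h (by omega)
            rw [hwc, dcomm G (w i) c] at this
            omega
          · have := hw U i h (by omega)
            rw [hwc] at this
            omega
        have e1 := dcomm G c (par v)
        omega
      have hsub' : (cnt G r {f | f ∈ Eset G W x j ∧ f ∈ Eset G W' x j ∧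
          r ≤ edgeDist G s(v, par v) f} : ℝ) ≤ (cnt G r {e | e ∈ G.edgeSet ∧ ∀ u ∈ e, u ∈ W' ∧
          ∀ i, U - y ≤ i → i ≤ U - y + m → ρ ≤ G.dist (w i) u} : ℝ) := by exact_mod_cast hsub
      have h1 := (mul_le_mul_of_nonneg_right hsub' (pow_pos hb0 m).le).trans hcut
      rw [← hy]
      have h2 : β ^ (W'.card - 1 + (ρ - j)) * (β⁻¹) ^ (2 * y) * β ^ m =
          β ^ (W'.card - 1) * β ^ (ρ - j + m - 2 * y) := by
        have e1 : (β⁻¹) ^ (2 * y) * β ^ (2 * y) = 1 := by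
          rw [← mul_pow, inv_mul_cancel₀ hb0.ne', one_pow]
        have e2 : β ^ (W'.card - 1 + (ρ - j)) * β ^ m =
            β ^ (W'.card - 1) * β ^ (ρ - j + m - 2 * y) * β ^ (2 * y) := by
          rw [← pow_add, ← pow_add, ← pow_add]; congr 1; omega
        calc _ = (β⁻¹) ^ (2 * y) * (β ^ (W'.card - 1 + (ρ - j)) * β ^ m) := by ring
          _ = ((β⁻¹) ^ (2 * y) * β ^ (2 * y)) *
              (β ^ (W'.card - 1) * β ^ (ρ - j + m - 2 * y)) := by rw [e2]; ring
          _ = _ := by rw [e1, one_mul]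
      have h3 : β ^ (W'.card - 1) ≤ β ^ (W'.card - 1) * β ^ (ρ - j + m - 2 * y) :=
        le_mul_of_one_le_right (pow_pos hb0 _).le (one_le_pow₀ hβ.le)
      rw [← h2] at h3
      exact le_of_mul_le_mul_right (h1.trans h3) (pow_pos hb0 m)

theorem main_claim (hG : G.IsTree) (β : ℝ) (ρ : ℕ) (hβ : 1 < β) (hρ : 1 ≤ ρ) (hr : 2 * ρ ≤ r)
    (hM : ∀ n : ℕ, 1 + ((n : ℝ) - ρ) + ∑ i ∈ Finset.range ρ, (β⁻¹) ^ (2 * (i + 1)) ≤ β ^ n)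
    (hB : 1 ≤ β ^ (2 * ρ) * (β - 1)) (N : ℕ) :
    ∀ W : Finset V, W.card = N → ConvexS G W → ∀ x ∈ W, ∀ j ≤ ρ,
      (cnt G r (Eset G W x j) : ℝ) ≤ β ^ (W.card - 1 + (ρ - j)) := by
  classical
  induction N using Nat.strong_induction_on with
  | _ N IH0 =>
  intro W hWN hW x hx j hj
  have IH : ∀ W' : Finset V, W'.card < W.card → ConvexS G W' → ∀ x ∈ W', ∀ j ≤ ρ,
      (cnt G r (Eset G W' x j) : ℝ) ≤ β ^ (W'.card - 1 + (ρ - j)) :=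
    fun W' h => IH0 W'.card (by omega) W' rfl
  by_cases hsm : SmallT G r (Tset G W x x)
  · exact case_small hG β ρ hβ hM W hW x hx j hj hsm
  obtain ⟨c, hc, hmax⟩ := Finset.exists_max_image
    (W.filter (fun c => ¬ SmallT G r (Tset G W x c))) (fun v => G.dist x v)
    ⟨x, Finset.mem_filter.2 ⟨hx, hsm⟩⟩
  rw [Finset.mem_filter] at hc
  have hchild : ∀ a ∈ W, G.dist x a = G.dist x c + 1 → SmallT G r (Tset G W x a) := by
    intro a ha hxa
    by_contra hn
    have : G.dist x a ≤ G.dist x c := hmax a (Finset.mem_filter.2 ⟨ha, hn⟩)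
    omega
  by_cases hfar : ∃ a ∈ W, G.Adj c a ∧ G.dist x a = G.dist x c + 1 ∧
      ∃ z ∈ W, G.dist z a < G.dist z c ∧ r + 1 ≤ G.dist a z
  · obtain ⟨a, ha, hca, hxa, hz⟩ := hfar
    exact case_far hG β ρ hβ hr hB W hW x hx j (fun W' h1 h2 h3 => IH W' h1 h2 x h3 j hj)
      hca hxa ha (hchild a ha hxa) hz
  have hdep : ∀ a ∈ W, G.Adj c a → G.dist x a = G.dist x c + 1 →
      ∀ v ∈ W, G.dist v a < G.dist v c → G.dist a v ≤ r := by
    intro a ha hca hxa v hv hva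
    by_contra hn
    exact hfar ⟨a, ha, hca, hxa, v, hv, hva, by omega⟩
  -- the main step, for an ordered pair
  have step : ∀ u p u' p', u ∈ Tset G W x c → p ∈ Tset G W x c → u' ∈ Tset G W x c →
      p' ∈ Tset G W x c → G.Adj u p → G.dist x p + 1 = G.dist x u → G.Adj u' p' →
      G.dist x p' + 1 = G.dist x u' → s(u, p) ≠ s(u', p') → r ≤ edgeDist G s(u, p) s(u', p') →
      ρ ≤ G.dist c p' → (cnt G r (Eset G W x j) : ℝ) ≤ β ^ (W.card - 1 + (ρ - j)) := by
    intro u p u' p' hu hp hu' hp' hup hxp hup' hxp' hne hd hcp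
    have huc : c ≠ u := by
      rintro rfl
      have := hp.2
      omega
    obtain ⟨a, hca, hua⟩ := exists_par hG huc
    have ha : a ∈ W := by
      apply hW c hc.1 u hu.1
      rw [dist_eq_one_iff_adj.2 hca, dcomm G a u, dcomm G c u]; omega
    have hxa : G.dist x a = G.dist x c + 1 := by
      have h1 := hu.2
      have h2 : G.dist x u ≤ G.dist x a + G.dist a u := hG.1.dist_triangle
      have h3 := adj_dist hG hca x
      have e1 := dcomm G a u
      have e2 := dcomm G c u
      omega
    refine case_near hG β ρ hβ hρ hr hM hB W hW x hx j hj IH hca hxa ha (hchild a ha hxa)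
      (hdep a ha hca hxa) hu'.1 hu'.2 ?_ ?_
    · by_contra hn
      have h1 : G.dist u' a < G.dist u' c := by
        have := adj_dist_ne hG hca u'
        omega
      have := branch_conf hG hca hxa (hchild a ha hxa) (hdep a ha hca hxa) hu.1 hp.1 hu'.1 hp'.1
        (by omega) h1 hup hxp hup' hxp' hne
      omega
    · have := hu'.2
      have := hp'.2
      omega
  have hns := hc.2
  unfold SmallT at hns
  push Not at hns
  obtain ⟨e, he, f, hf, heT, hfT, hne, hd⟩ := hns
  obtain ⟨u, p, rfl, hup, hxp⟩ := edge_par hG x he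
  obtain ⟨u', p', rfl, hup', hxp'⟩ := edge_par hG x hf
  have h1 := edgeDist_le (G := G) (e := s(u, p)) (f := s(u', p')) (u := p) (w := p')
    (by simp) (by simp)
  have h2 : G.dist p p' ≤ G.dist p c + G.dist c p' := hG.1.dist_triangle
  have e1 := dcomm G p c
  by_cases h : ρ ≤ G.dist c p'
  · exact step u p u' p' (heT u (by simp)) (heT p (by simp)) (hfT u' (by simp)) (hfT p' (by simp))
      hup hxp hup' hxp' hne hd h
  · exact step u' p' u p (hfT u' (by simp)) (hfT p' (by simp)) (heT u (by simp)) (heT p (by simp))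
      hup' hxp' hup hxp hne.symm (by rw [edgeDist_comm]; exact hd) (by omega)
end fin

/-- For `r ≥ 2`, `s > 0` the unique real with `r/2 + s = (s+1)·log(s+1)` and
`α_r = e^{1/(s+1)}`, every tree `T` on `n` vertices has at most
`(s+1) · (e^{1/r} α_r)^{n-1}` `r`-matchings. -/
theorem stmt17 (r : ℕ) (hr : 2 ≤ r) (s : ℝ) (hs : 0 < s)
    (heq : (r : ℝ) / 2 + s = (s + 1) * Real.log (s + 1))
    {V : Type*} [Fintype V] (G : SimpleGraph V) (hG : G.IsTree) :
    (numRMatchings G r : ℝ) ≤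
      (s + 1) * (Real.exp (1 / r) * Real.exp (1 / (s + 1))) ^ (Fintype.card V - 1) := by
  classical
  obtain ⟨β, hβ⟩ : ∃ β, β = Real.exp (1 / (r : ℝ)) * Real.exp (1 / (s + 1)) := ⟨_, rfl⟩
  obtain ⟨ρ, hρ⟩ : ∃ ρ, ρ = r / 2 := ⟨_, rfl⟩
  obtain ⟨h1, hM, hB, hD⟩ := num_facts r hr s hs heq β ρ hρ hβ
  obtain ⟨x⟩ := hG.1.nonempty
  have h := main_claim (r := r) hG β ρ h1 (by omega) (by omega) hM hB _ Finset.univ rfl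
    (fun _ _ _ _ _ _ => Finset.mem_univ _) x (Finset.mem_univ x) 0 (by omega)
  have hn : numRMatchings G r = cnt G r (Eset G Finset.univ x 0) := by
    unfold numRMatchings cnt mats
    rw [Nat.card_eq_fintype_card, Fintype.card_subtype]
    congr 1
    ext M
    simp only [Finset.mem_filter, Finset.mem_univ, true_and]
    constructor
    · intro h
      exact ⟨h, fun e he => ⟨h.1 e he, fun u _ => ⟨Finset.mem_univ _, Nat.zero_le _⟩⟩⟩
    · exact fun h => h.1
  rw [hn, ← hβ]
  refine h.trans ?_
  rw [Nat.sub_zero, pow_add, Finset.card_univ, mul_comm]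
  exact mul_le_mul_of_nonneg_right hD (by positivity)
end

section
/- For all sufficiently large integers r, there exist an integer n and a tree T on n vertices such that the number of r-matchings in T is strictly greater than the number of r-matchings in the path P_n on n vertices. -/
open SimpleGraph Filter

/-- Every vertex `v` of the spider has this parent (`0` is the root). -/
def spPar (h v : ℕ) : ℕ := if v ≤ 3 * h then v - 3 else 3 * h - 2 + (v + 2) % 3

lemma spPar_lt (h v : ℕ) (hh : 1 ≤ h) (hv : 1 ≤ v) : spPar h v < v := by
  unfold spPar; split_ifs <;> omega

/-- A spider with three legs of length `h` and pendant leaves at the ends. -/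
def spider (h n : ℕ) : SimpleGraph (Fin n) where
  Adj u v := u ≠ v ∧ (u.val = spPar h v.val ∨ v.val = spPar h u.val)
  symm := ⟨fun u v huv => ⟨huv.1.symm, huv.2.symm⟩⟩
  loopless := ⟨fun u hu => hu.1 rfl⟩

lemma spider_connected (h m : ℕ) (hh : 1 ≤ h) : (spider h (m + 1)).Connected := by
  have key : ∀ k : ℕ, ∀ hk : k < m + 1, (spider h (m + 1)).Reachable ⟨k, hk⟩ 0 := by
    intro k
    induction k using Nat.strong_induction_on with
    | _ k ih =>
      intro hk
      rcases Nat.eq_zero_or_pos k with rfl | hpos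
      · exact Reachable.refl _
      · have hlt := spPar_lt h k hh hpos
        have hadj : (spider h (m + 1)).Adj ⟨k, hk⟩ ⟨spPar h k, hlt.trans hk⟩ := by
          refine ⟨?_, Or.inr rfl⟩
          intro he
          have := congrArg Fin.val he
          simp at this
          omega
        exact hadj.reachable.trans (ih _ hlt _)
  haveI : Nonempty (Fin (m + 1)) := ⟨0⟩
  exact Connected.mk fun u v => (key u.1 u.2).trans (key v.1 v.2).symm

lemma spider_isTree (h m : ℕ) (hh : 1 ≤ h) : (spider h (m + 1)).IsTree := by
  classical
  rw [isTree_iff_connected_and_card]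
  refine ⟨spider_connected h m hh, ?_⟩
  have hl : ∀ i : Fin m, spPar h (i.1 + 1) < m + 1 := fun i => by
    have := spPar_lt h (i.1 + 1) hh (by omega)
    omega
  let f : Fin m → (spider h (m + 1)).edgeSet := fun i =>
    ⟨s(⟨i.1 + 1, by omega⟩, ⟨spPar h (i.1 + 1), hl i⟩), by
      have := spPar_lt h (i.1 + 1) hh (by omega)
      refine ⟨?_, Or.inr rfl⟩
      intro he
      have := congrArg Fin.val he
      simp at this
      omega⟩
  have hf : Function.Bijective f := by
    constructor
    · intro i j hij
      have h1 := spPar_lt h (i.1 + 1) hh (by omega)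
      have h2 := spPar_lt h (j.1 + 1) hh (by omega)
      have := congrArg Subtype.val hij
      simp only [f, Sym2.eq_iff, Fin.mk.injEq] at this
      ext
      omega
    · rintro ⟨e, he⟩
      induction e using Sym2.ind with
      | _ u v =>
        have he' : u ≠ v ∧ (u.val = spPar h v.val ∨ v.val = spPar h u.val) := he
        have hne : u.val ≠ v.val := fun hc => he'.1 (Fin.ext hc)
        have p0 : spPar h 0 = 0 := by simp [spPar]
        rcases he'.2 with h1 | h1
        · have hv : v.val ≠ 0 := by
            intro h0; rw [h0, p0] at h1; omega
          have hv1 : v.val - 1 + 1 = v.val := by omega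
          refine ⟨⟨v.val - 1, by omega⟩, ?_⟩
          apply Subtype.ext
          simp only [f, Sym2.eq_iff, Fin.ext_iff, hv1]
          right; exact ⟨trivial, h1.symm⟩
        · have hv : u.val ≠ 0 := by
            intro h0; rw [h0, p0] at h1; omega
          have hv1 : u.val - 1 + 1 = u.val := by omega
          refine ⟨⟨u.val - 1, by omega⟩, ?_⟩
          apply Subtype.ext
          simp only [f, Sym2.eq_iff, Fin.ext_iff, hv1]
          left; exact ⟨trivial, h1.symm⟩
  have := Nat.card_congr (Equiv.ofBijective f hf)
  rw [← this]
  simp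

/-- Signed depth, positive on leg `i`, negative on leg `j`. -/
def spPhi (h i j v : ℕ) : ℤ :=
  if (v + 2) % 3 = i then (min ((v + 2) / 3) (h + 1) : ℕ)
  else if (v + 2) % 3 = j then -((min ((v + 2) / 3) (h + 1) : ℕ) : ℤ) else 0

lemma spPhi_step (h i j v : ℕ) (hh : 1 ≤ h) :
    |spPhi h i j v - spPhi h i j (spPar h v)| ≤ 1 := by
  rcases Nat.eq_zero_or_pos v with rfl | hv
  · simp [spPar]
  rw [abs_le]
  unfold spPhi spPar
  by_cases h1 : v ≤ 3 * h
  · by_cases h3 : v ≤ 3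
    · have : v - 3 = 0 := by omega
      rw [if_pos h1, this]
      constructor <;> split_ifs <;> omega
    · have : (v - 3 + 2) % 3 = (v + 2) % 3 := by omega
      rw [if_pos h1, this]
      constructor <;> split_ifs <;> omega
  · have : (3 * h - 2 + (v + 2) % 3 + 2) % 3 = (v + 2) % 3 := by omega
    rw [if_neg h1, this]
    constructor <;> split_ifs <;> omega

lemma spPhi_walk (h n i j : ℕ) (hh : 1 ≤ h) {u v : Fin n} (p : (spider h n).Walk u v) :
    |spPhi h i j u.val - spPhi h i j v.val| ≤ p.length := by
  induction p with
  | nil => simp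
  | @cons a b c hab p ih =>
    have h1 : |spPhi h i j a.val - spPhi h i j b.val| ≤ 1 := by
      rcases hab.2 with h1 | h1
      · rw [h1, abs_sub_comm]; exact spPhi_step h i j b.val hh
      · rw [h1]; exact spPhi_step h i j a.val hh
    rw [Walk.length_cons]
    push_cast
    rw [abs_le] at *
    constructor <;> linarith [h1.1, h1.2, ih.1, ih.2]

lemma spider_dist (h m : ℕ) (hh : 1 ≤ h) (u v : Fin (m + 1)) (hu : 3 * h - 2 ≤ u.val)
    (hv : 3 * h - 2 ≤ v.val) (huv : (u.val + 2) % 3 ≠ (v.val + 2) % 3) :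
    2 * h ≤ (spider h (m + 1)).dist u v := by
  obtain ⟨p, hp⟩ := (spider_connected h m hh).exists_walk_length_eq_dist u v
  have := spPhi_walk h (m + 1) ((u.val + 2) % 3) ((v.val + 2) % 3) hh p
  rw [hp, abs_le] at this
  have h2 := this.2
  unfold spPhi at h2
  rw [if_pos rfl, if_neg huv.symm, if_pos rfl] at h2
  omega

lemma le_edgeDist {V : Type*} (G : SimpleGraph V) (r : ℕ) (a b c d : V)
    (h1 : r ≤ G.dist a c) (h2 : r ≤ G.dist a d) (h3 : r ≤ G.dist b c) (h4 : r ≤ G.dist b d) :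
    r ≤ edgeDist G s(a, b) s(c, d) := by
  unfold edgeDist
  apply le_csInf
  · exact ⟨_, a, by simp, c, by simp, rfl⟩
  · rintro _ ⟨u, hu, w, hw, rfl⟩
    simp only [Sym2.mem_iff] at hu hw
    rcases hu with rfl | rfl <;> rcases hw with rfl | rfl <;> assumption

lemma edgeDist_le_s19 {V : Type*} (G : SimpleGraph V) (a b c d : V) :
    edgeDist G s(a, b) s(c, d) ≤ G.dist b c :=
  Nat.sInf_le ⟨b, by simp, c, by simp, rfl⟩

/-- Leaf edge number `x` of leg `i`. -/
def leafEdge (h a : ℕ) (i : Fin 3) (x : Fin a) : Sym2 (Fin (3 * h + 3 * a + 1)) :=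
  s(⟨3 * h + 1 + 3 * x.1 + i.1, by omega⟩, ⟨3 * h - 2 + i.1, by have := x.2; omega⟩)

lemma leafEdge_inj (h a : ℕ) (hh : 1 ≤ h) (i j : Fin 3) (x y : Fin a)
    (he : leafEdge h a i x = leafEdge h a j y) : i = j ∧ x = y := by
  simp only [leafEdge, Sym2.eq_iff, Fin.mk.injEq] at he
  constructor <;> ext <;> omega

lemma spider_lower (h a r : ℕ) (hh : 1 ≤ h) (hr : r ≤ 2 * h) :
    (a + 1) ^ 3 ≤ numRMatchings (spider h (3 * h + 3 * a + 1)) r := by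
  classical
  let F : (Fin 3 → Option (Fin a)) →
      {M : Finset (Sym2 (Fin (3 * h + 3 * a + 1))) //
        IsRMatching (spider h (3 * h + 3 * a + 1)) r M} := fun c =>
    ⟨Finset.univ.filter (fun e => ∃ i x, c i = some x ∧ e = leafEdge h a i x), by
      constructor
      · intro e he
        obtain ⟨i, x, -, rfl⟩ := (Finset.mem_filter.1 he).2
        refine ⟨?_, Or.inr ?_⟩
        · intro hc
          have := congrArg Fin.val hc
          simp at this
          omega
        · simp only [spPar]
          rw [if_neg (by omega)]
          omega
      · intro e he f hf hne
        obtain ⟨i, x, hx, rfl⟩ := (Finset.mem_filter.1 he).2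
        obtain ⟨j, y, hy, rfl⟩ := (Finset.mem_filter.1 hf).2
        have hij : i.1 ≠ j.1 := by
          intro hc
          obtain rfl : i = j := Fin.ext hc
          rw [hx] at hy
          obtain rfl := Option.some.inj hy
          exact hne rfl
        apply le_edgeDist <;>
        · refine hr.trans (spider_dist h _ hh _ _ ?_ ?_ ?_) <;> simp only [] <;> omega⟩
  have hF : Function.Injective F := by
    intro c c' hcc
    have hmem : ∀ (d : Fin 3 → Option (Fin a)) i x, leafEdge h a i x ∈ (F d).1 ↔ d i = some x := by
      intro d i x
      simp only [F, Finset.mem_filter, Finset.mem_univ, true_and]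
      constructor
      · rintro ⟨j, y, hd, he⟩
        obtain ⟨rfl, rfl⟩ := leafEdge_inj h a hh _ _ _ _ he
        exact hd
      · intro hd
        exact ⟨i, x, hd, rfl⟩
    funext i
    apply Option.ext
    intro x
    rw [← hmem c, ← hmem c', hcc]
  have := Nat.card_le_card_of_injective F hF
  simpa [numRMatchings] using this

lemma path_dist (n : ℕ) : ∀ d : ℕ, ∀ u v : Fin (n + 1), v.val = u.val + d →
    (pathGraph (n + 1)).dist u v ≤ d := by
  intro d
  induction d with
  | zero =>
    intro u v huv
    obtain rfl : v = u := Fin.ext (by omega)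
    simp
  | succ d ih =>
    intro u v huv
    let w : Fin (n + 1) := ⟨u.val + d, by omega⟩
    have h1 := ih u w rfl
    have h2 : (pathGraph (n + 1)).dist w v = 1 := by
      rw [dist_eq_one_iff_adj, pathGraph_adj]
      left; simp only [w]; omega
    have := (pathGraph_connected n).dist_triangle (u := u) (v := w) (w := v)
    omega

/-- Edge number `k` of the path lies in `M`. -/
def HasE {n : ℕ} (M : Finset (Sym2 (Fin n))) (k : ℕ) : Prop :=
  ∃ u w : Fin n, u.val = k ∧ w.val = k + 1 ∧ s(u, w) ∈ M

lemma hasE_close {n r : ℕ} {M : Finset (Sym2 (Fin (n + 1)))}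
    (hM : IsRMatching (pathGraph (n + 1)) r M) {k l : ℕ} (hk : HasE M k) (hl : HasE M l)
    (hkl : k < l) : k + r + 1 ≤ l := by
  obtain ⟨u, w, hu, hw, hm⟩ := hk
  obtain ⟨u', w', hu', hw', hm'⟩ := hl
  have h1 := hM.2 _ hm _ hm' (by
    intro hc
    simp only [Sym2.eq_iff, Fin.ext_iff] at hc
    omega)
  have h2 := edgeDist_le_s19 (pathGraph (n + 1)) u w u' w'
  have h3 := path_dist n (l - (k + 1)) w u' (by omega)
  omega

lemma hasE_ext {n r : ℕ} {M M' : Finset (Sym2 (Fin (n + 1)))}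
    (hM : IsRMatching (pathGraph (n + 1)) r M) (h : ∀ k < n, HasE M k → HasE M' k) :
    M ⊆ M' := by
  have main : ∀ u v : Fin (n + 1), u.val + 1 = v.val → s(u, v) ∈ M → s(u, v) ∈ M' := by
    intro u v huv hm
    obtain ⟨u', w', h1, h2, h3⟩ := h u.val (by omega) ⟨u, v, rfl, huv.symm, hm⟩
    obtain rfl : u' = u := Fin.ext h1
    obtain rfl : w' = v := Fin.ext (by omega)
    exact h3
  intro e he
  have hadj := hM.1 e he
  induction e using Sym2.ind with
  | _ u v =>
    rw [mem_edgeSet, pathGraph_adj] at hadj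
    rcases hadj with h1 | h1
    · exact main u v h1 he
    · rw [Sym2.eq_swap] at he ⊢
      exact main v u h1 he

lemma path_upper (n r : ℕ) (hn : n ≤ 2 * (r + 1)) :
    numRMatchings (pathGraph (n + 1)) r ≤ (r + 2) ^ 2 := by
  classical
  let F : {M : Finset (Sym2 (Fin (n + 1))) // IsRMatching (pathGraph (n + 1)) r M} →
      (Fin 2 → Option (Fin (r + 1))) := fun M b =>
    if hx : ∃ x : Fin (r + 1), HasE M.1 (b.1 * (r + 1) + x.1) then some hx.choose else none
  have hmem : ∀ M b x, F M b = some x ↔ HasE M.1 (b.1 * (r + 1) + x.1) := by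
    intro M b x
    simp only [F]
    split_ifs with hx
    · have hc := hx.choose_spec
      constructor
      · intro he
        rw [← Option.some.inj he]; exact hc
      · intro he
        congr 1
        ext
        by_contra hne
        rcases Nat.lt_or_gt_of_ne hne with hlt | hlt
        · have := hasE_close M.2 hc he (by omega)
          omega
        · have := hasE_close M.2 he hc (by omega)
          omega
    · constructor
      · intro h; cases h
      · intro h; exact absurd ⟨x, h⟩ hx
  have hsub : ∀ M M', F M = F M' → M.1 ⊆ M'.1 := by
    intro M M' hMM
    apply hasE_ext M.2
    intro k hk hE
    have hb : k / (r + 1) < 2 := by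
      rw [Nat.div_lt_iff_lt_mul (by omega)]; omega
    have hk' : k / (r + 1) * (r + 1) + k % (r + 1) = k := Nat.div_add_mod' k (r + 1)
    have h1 := (hmem M ⟨k / (r + 1), hb⟩ ⟨k % (r + 1), Nat.mod_lt _ (by omega)⟩).2
      (by simpa only [hk'] using hE)
    rw [hMM, hmem] at h1
    simpa only [hk'] using h1
  have hF : Function.Injective F := fun M M' h =>
    Subtype.ext (Finset.Subset.antisymm (hsub M M' h) (hsub M' M h.symm))
  have := Nat.card_le_card_of_injective F hF
  simpa [numRMatchings] using this

/-- For all sufficiently large `r`, there exist `n` and a tree on `n` vertices having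
strictly more `r`-matchings than the path `P_n`. -/
theorem stmt19 :
    ∃ R : ℕ, ∀ r : ℕ, R ≤ r →
      ∃ (n : ℕ) (G : SimpleGraph (Fin n)), G.IsTree ∧
        numRMatchings (SimpleGraph.pathGraph n) r < numRMatchings G r := by
  refine ⟨1000, fun r hr => ?_⟩
  refine ⟨3 * ((r + 1) / 2) + 3 * (r / 6) + 1, spider ((r + 1) / 2) _,
    spider_isTree _ _ (by omega), ?_⟩
  refine (path_upper _ r (by omega)).trans_lt
    (lt_of_lt_of_le ?_ (spider_lower _ _ r (by omega) (by omega)))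
  have h1 : r + 2 ≤ 7 * (r / 6 + 1) := by omega
  have h2 : 49 < r / 6 + 1 := by omega
  generalize r / 6 + 1 = y at *
  calc (r + 2) ^ 2 ≤ (7 * y) ^ 2 := Nat.pow_le_pow_left h1 2
    _ = 49 * y ^ 2 := by ring
    _ < y * y ^ 2 := Nat.mul_lt_mul_of_pos_right h2 (by positivity)
    _ = y ^ 3 := by ring
end
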